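/- arXiv:2005.11790 — 2 statements merged into one kernel-verified Lean document; each statement's English description precedes it below -/
import Mathlib

section
/- Let n > m ≥ 1 be integers and let s > m. Let Λ be a compact metric space, ω a finite nonzero Borel measure on Λ, and (P_λ)_{λ∈Λ} a family of orthogonal projections from ℝⁿ onto ℝᵐ such that λ ↦ P_λ x is continuous for every x ∈ ℝⁿ. Suppose that for every μ ∈ M(Bⁿ(0,1)) satisfying μ(B(x,r)) ≤ r^s for all x ∈ ℝⁿ and r > 0, the push-forward P_{λ♯}μ is absolutely continuous with respect to Lebesgue measure L^m for ω-almost all λ ∈ Λ, and that there is a constant C > 0 (independent of μ) such that ∫_Λ ∫_{ℝᵐ} D(P_{λ♯}μ, u)² dL^m(u) dω(λ) < C for all such μ. If A ⊂ ℝⁿ is H^s-measurable with 0 < H^s(A) < ∞ and the lower density θ^s_*(A,x) > 0 for H^s-almost all x ∈ A, then for H^s×ω-almost all (x,λ) ∈ A×Λ the Hausdorff dimension of P_λ⁻¹{P_λ x} ∩ A equals s − m. -/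
open MeasureTheory Metric Filter
open scoped ENNReal Topology

noncomputable section

/-- `P : ℝⁿ → ℝᵐ` is an orthogonal projection: a surjective linear map whose restriction to
the orthogonal complement of its kernel is an isometry. -/
def IsOrthoProj {E F : Type*} [NormedAddCommGroup E] [InnerProductSpace ℝ E]
    [NormedAddCommGroup F] [InnerProductSpace ℝ F] (P : E →ₗ[ℝ] F) : Prop :=
  Function.Surjective P ∧ ∀ x ∈ (LinearMap.ker P)ᗮ, ‖P x‖ = ‖x‖

/-- The derivative `D(ν,u) = lim_{δ→0} α(m)⁻¹ δ^{-m} ν(B(u,δ))` of a measure `ν` on `ℝᵐ`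
(junk value if the limit does not exist). -/
def densD {m : ℕ} (ν : Measure (EuclideanSpace ℝ (Fin m))) (u : EuclideanSpace ℝ (Fin m)) :
    ℝ≥0∞ :=
  limUnder (𝓝[>] (0 : ℝ)) fun δ : ℝ =>
    ν (closedBall u δ) /
      (volume (closedBall (0 : EuclideanSpace ℝ (Fin m)) 1) * ENNReal.ofReal (δ ^ m))

/-- The lower `s`-density `θ^s_*(A,x) = liminf_{r→0} (2r)^{-s} H^s(A ∩ B(x,r))`. -/
def lowerDensity {n : ℕ} (s : ℝ) (A : Set (EuclideanSpace ℝ (Fin n)))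
    (x : EuclideanSpace ℝ (Fin n)) : ℝ≥0∞ :=
  liminf (fun r : ℝ => μH[s] (A ∩ closedBall x r) / ENNReal.ofReal ((2 * r) ^ s)) (𝓝[>] 0)

theorem IsOrthoProj.norm_le {n m : ℕ}
    {P : EuclideanSpace ℝ (Fin n) →ₗ[ℝ] EuclideanSpace ℝ (Fin m)} (h : IsOrthoProj P)
    (x : EuclideanSpace ℝ (Fin n)) : ‖P x‖ ≤ ‖x‖ := by
  obtain ⟨y, hy, z, hz, rfl⟩ := Submodule.exists_add_mem_mem_orthogonal (K := LinearMap.ker P) x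
  have h1 : P (y + z) = P z := by
    rw [map_add, LinearMap.mem_ker.1 hy, zero_add]
  rw [h1, h.2 z hz]
  have h2 : inner ℝ y z = 0 := (Submodule.mem_orthogonal _ _).1 hz y hy
  have h3 := norm_add_sq_eq_norm_sq_add_norm_sq_of_inner_eq_zero y z h2
  nlinarith [norm_nonneg (y + z), norm_nonneg z, norm_nonneg y]

theorem joint_cont {n m : ℕ} {Λ : Type*} [MetricSpace Λ]
    {P : Λ → (EuclideanSpace ℝ (Fin n) →ₗ[ℝ] EuclideanSpace ℝ (Fin m))}
    (hP : ∀ l, IsOrthoProj (P l)) (hPcont : ∀ x, Continuous fun l => P l x) :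
    Continuous fun q : EuclideanSpace ℝ (Fin n) × Λ => P q.2 q.1 := by
  refine continuous_prod_of_continuous_lipschitzWith _ 1 (fun a => hPcont a) (fun l => ?_)
  refine LipschitzWith.of_dist_le_mul fun x y => ?_
  simp only [NNReal.coe_one, one_mul, dist_eq_norm, ← map_sub]
  exact (hP l).norm_le _

theorem proj_cont {n m : ℕ} (P : EuclideanSpace ℝ (Fin n) →ₗ[ℝ] EuclideanSpace ℝ (Fin m)) :
    Continuous P := P.continuous_of_finiteDimensional

/-- `ν` has an `L²` density with squared norm at most `K`. -/
def HasL2 {m : ℕ} (ν : Measure (EuclideanSpace ℝ (Fin m))) (K : ℝ≥0∞) : Prop :=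
  ∃ g : EuclideanSpace ℝ (Fin m) → ℝ≥0∞, Measurable g ∧ ν = volume.withDensity g ∧
    ∫⁻ u, g u ^ 2 ≤ K

/-- main hypothesis, as a predicate -/
def MainHyp {n m : ℕ} (s : ℝ) {Λ : Type*} [MeasurableSpace Λ] (ω : Measure Λ)
    (P : Λ → (EuclideanSpace ℝ (Fin n) →ₗ[ℝ] EuclideanSpace ℝ (Fin m))) (C : ℝ) : Prop :=
  ∀ μ : Measure (EuclideanSpace ℝ (Fin n)), IsFiniteMeasure μ → μ ≠ 0 →
      (∃ K, IsCompact K ∧ K ⊆ closedBall 0 1 ∧ μ Kᶜ = 0) →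
      (∀ x r, 0 < r → μ (closedBall x r) ≤ ENNReal.ofReal (r ^ s)) →
      (∀ᵐ l ∂ω, μ.map (P l) ≪ volume) ∧
        ∫⁻ l, ∫⁻ u, densD (μ.map (P l)) u ^ 2 ∂volume ∂ω < ENNReal.ofReal C

theorem densD_tendsto {m : ℕ} (ν : Measure (EuclideanSpace ℝ (Fin m))) [IsFiniteMeasure ν] :
    ∀ᵐ u, Tendsto (fun δ : ℝ =>
    ν (closedBall u δ) /
      (volume (closedBall (0 : EuclideanSpace ℝ (Fin m)) 1) * ENNReal.ofReal (δ ^ m)))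
      (𝓝[>] (0 : ℝ)) (𝓝 (ν.rnDeriv volume u)) := by
  filter_upwards [Besicovitch.ae_tendsto_rnDeriv ν volume] with u hu
  refine hu.congr' ?_
  filter_upwards [self_mem_nhdsWithin] with δ hδ
  rw [Measure.addHaar_closedBall' volume u (le_of_lt hδ), mul_comm]
  simp

/-- sequential version of the density, jointly measurable. -/
def seqD {n m : ℕ} {Λ : Type*}
    (P : Λ → (EuclideanSpace ℝ (Fin n) →ₗ[ℝ] EuclideanSpace ℝ (Fin m)))
    (μ : Measure (EuclideanSpace ℝ (Fin n))) (l : Λ) (u : EuclideanSpace ℝ (Fin m)) : ℝ≥0∞ :=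
  liminf (fun k : ℕ => μ {x | dist (P l x) u ≤ 1 / ((k : ℝ) + 1)} /
    (volume (closedBall (0 : EuclideanSpace ℝ (Fin m)) 1) *
      ENNReal.ofReal ((1 / ((k : ℝ) + 1)) ^ m))) atTop

theorem seqD_measurable {n m : ℕ} {Λ : Type*} [MetricSpace Λ] [CompactSpace Λ] [MeasurableSpace Λ]
    [BorelSpace Λ]
    {P : Λ → (EuclideanSpace ℝ (Fin n) →ₗ[ℝ] EuclideanSpace ℝ (Fin m))}
    (hP : ∀ l, IsOrthoProj (P l)) (hPcont : ∀ x, Continuous fun l => P l x)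
    (μ : Measure (EuclideanSpace ℝ (Fin n))) [IsFiniteMeasure μ] :
    Measurable fun q : Λ × EuclideanSpace ℝ (Fin m) => seqD P μ q.1 q.2 := by
  unfold seqD
  refine Measurable.liminf fun k => ?_
  refine Measurable.div_const ?_ _
  have hcl : IsClosed {z : (Λ × EuclideanSpace ℝ (Fin m)) × EuclideanSpace ℝ (Fin n) |
      dist (P z.1.1 z.2) z.1.2 ≤ 1 / ((k : ℝ) + 1)} := by
    refine isClosed_le (Continuous.dist ?_ (by fun_prop)) continuous_const
    exact (joint_cont hP hPcont).comp
      (g := fun q : EuclideanSpace ℝ (Fin n) × Λ => P q.2 q.1)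
      (f := fun z : (Λ × EuclideanSpace ℝ (Fin m)) × EuclideanSpace ℝ (Fin n) => (z.2, z.1.1))
      (by fun_prop)
  exact measurable_measure_prodMk_left hcl.measurableSet

theorem step1 {n m : ℕ} {s : ℝ}
    {Λ : Type*} [MetricSpace Λ] [CompactSpace Λ] [MeasurableSpace Λ] [BorelSpace Λ]
    {ω : Measure Λ} [IsFiniteMeasure ω]
    {P : Λ → (EuclideanSpace ℝ (Fin n) →ₗ[ℝ] EuclideanSpace ℝ (Fin m))}
    (hP : ∀ l, IsOrthoProj (P l)) (hPcont : ∀ x, Continuous fun l => P l x)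
    {C : ℝ} (hmain : MainHyp s ω P C)
    (μ : Measure (EuclideanSpace ℝ (Fin n))) [IsFiniteMeasure μ]
    (hsupp : μ (closedBall 0 1)ᶜ = 0)
    (hfr : ∀ x r, 0 < r → μ (closedBall x r) ≤ ENNReal.ofReal (r ^ s)) :
    ∃ G : Λ → ℝ≥0∞, Measurable G ∧ ∫⁻ l, G l ∂ω ≤ ENNReal.ofReal C ∧
      ∀ᵐ l ∂ω, HasL2 (μ.map (P l)) (G l) := by
  rcases eq_or_ne μ 0 with h0 | h0
  · refine ⟨0, measurable_const, by simp, Eventually.of_forall fun l => ⟨0, measurable_const, ?_, ?_⟩⟩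
    · simp [h0]
    · simp
  obtain ⟨hac, hbd0⟩ := hmain μ inferInstance h0
    ⟨closedBall 0 1, isCompact_closedBall _ _, subset_rfl, hsupp⟩ hfr
  have hkey : ∀ l, (∀ᵐ u, densD (μ.map (P l)) u = (μ.map (P l)).rnDeriv volume u) ∧
      (∀ᵐ u, seqD P μ l u = (μ.map (P l)).rnDeriv volume u) := by
    intro l
    have hfin : IsFiniteMeasure (μ.map (P l)) := inferInstance
    refine ⟨?_, ?_⟩
    · filter_upwards [densD_tendsto (μ.map (P l))] with u hu
      exact hu.limUnder_eq
    · filter_upwards [densD_tendsto (μ.map (P l))] with u hu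
      have hseq : Tendsto (fun k : ℕ => 1 / ((k : ℝ) + 1)) atTop (𝓝[>] 0) := by
        refine tendsto_nhdsWithin_iff.2 ⟨tendsto_one_div_add_atTop_nhds_zero_nat, ?_⟩
        exact Eventually.of_forall fun k => by simp only [Set.mem_Ioi]; positivity
      have := (hu.comp hseq).liminf_eq
      rw [← this]
      unfold seqD
      congr 1
      funext k
      simp only [Function.comp]
      rw [Measure.map_apply (proj_cont (P l)).measurable isClosed_closedBall.measurableSet]
      rfl
  refine ⟨fun l => ∫⁻ u, seqD P μ l u ^ 2, ?_, ?_, ?_⟩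
  · exact Measurable.lintegral_prod_right' (f := fun q : Λ × EuclideanSpace ℝ (Fin m) =>
      seqD P μ q.1 q.2 ^ 2) ((seqD_measurable hP hPcont μ).pow_const 2)
  · refine le_trans (le_of_eq ?_) hbd0.le
    refine lintegral_congr fun l => lintegral_congr_ae ?_
    filter_upwards [(hkey l).1, (hkey l).2] with u h1 h2
    rw [h1, h2]
  · filter_upwards [hac] with l hl
    refine ⟨(μ.map (P l)).rnDeriv volume, Measure.measurable_rnDeriv _ _,
      (Measure.withDensity_rnDeriv_eq _ _ hl).symm, le_of_eq (lintegral_congr_ae ?_)⟩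
    filter_upwards [(hkey l).2] with u h2
    rw [h2]

theorem lintegral_scale {m : ℕ} {r : ℝ} (hr : 0 < r) (b : EuclideanSpace ℝ (Fin m))
    (h : EuclideanSpace ℝ (Fin m) → ℝ≥0∞) (hh : Measurable h) :
    ∫⁻ u, h (r⁻¹ • (u - b)) = ENNReal.ofReal (r ^ m) * ∫⁻ v, h v := by
  have h1 := lintegral_sub_right_eq_self (μ := (volume : Measure (EuclideanSpace ℝ (Fin m))))
    (fun v => h (r⁻¹ • v)) b
  rw [h1]
  have h2 := Measure.map_addHaar_smul (volume : Measure (EuclideanSpace ℝ (Fin m)))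
    (inv_ne_zero hr.ne')
  have h3 : ∫⁻ v, h v ∂(Measure.map (fun x => r⁻¹ • x)
      (volume : Measure (EuclideanSpace ℝ (Fin m)))) = ∫⁻ u, h (r⁻¹ • u) :=
    lintegral_map hh (measurable_const_smul _)
  rw [← h3, h2, lintegral_smul_measure]
  simp [abs_of_pos hr]

theorem HasL2.scale {m : ℕ} {r : ℝ} (hr : 0 < r) (b : EuclideanSpace ℝ (Fin m))
    {ν : Measure (EuclideanSpace ℝ (Fin m))} {c K : ℝ≥0∞} (hc : c ≠ 0) (hc' : c ≠ ∞)
    (h : HasL2 (c • ν.map (fun u => r⁻¹ • (u - b))) K) :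
    HasL2 ν (c⁻¹ ^ 2 * ENNReal.ofReal ((r ^ m)⁻¹) * K) := by
  obtain ⟨g, hg, hν, hK⟩ := h
  have hSm : Measurable (fun u : EuclideanSpace ℝ (Fin m) => r⁻¹ • (u - b)) := by fun_prop
  have hrm : (0 : ℝ) < r ^ m := by positivity
  refine ⟨fun u => c⁻¹ * ENNReal.ofReal ((r ^ m)⁻¹) * g (r⁻¹ • (u - b)),
    (hg.comp hSm).const_mul _, ?_, ?_⟩
  · ext X hX
    set Y : Set (EuclideanSpace ℝ (Fin m)) := (fun v => r • v + b) ⁻¹' X with hY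
    have hYm : MeasurableSet Y := by
      have : Measurable (fun v : EuclideanSpace ℝ (Fin m) => r • v + b) := by fun_prop
      exact this hX
    have hXY : X = (fun u => r⁻¹ • (u - b)) ⁻¹' Y := by
      ext u
      simp [hY, smul_smul, hr.ne']
    have h1 : c * ν X = ∫⁻ v in Y, g v := by
      rw [← withDensity_apply _ hYm, ← hν, Measure.smul_apply, Measure.map_apply hSm hYm, ← hXY,
        smul_eq_mul]
    have h2 : ∫⁻ u, (Y.indicator g) (r⁻¹ • (u - b)) =
        ENNReal.ofReal (r ^ m) * ∫⁻ v in Y, g v := by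
      rw [lintegral_scale hr b _ (hg.indicator hYm), lintegral_indicator hYm]
    have h3 : ∫⁻ u, (Y.indicator g) (r⁻¹ • (u - b)) = ∫⁻ u in X, g (r⁻¹ • (u - b)) := by
      rw [← lintegral_indicator hX]
      refine lintegral_congr fun u => ?_
      simp only [Set.indicator]
      rw [hXY]
      rfl
    rw [withDensity_apply _ hX, lintegral_const_mul _ (show Measurable fun u => g (r⁻¹ • (u - b)) from hg.comp hSm), ← h3, h2, ← h1]
    have h4 : ENNReal.ofReal ((r ^ m)⁻¹) * ENNReal.ofReal (r ^ m) = 1 := by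
      rw [← ENNReal.ofReal_mul (by positivity), inv_mul_cancel₀ hrm.ne', ENNReal.ofReal_one]
    calc ν X = (c⁻¹ * c) * 1 * ν X := by rw [ENNReal.inv_mul_cancel hc hc']; simp
      _ = _ := by rw [← h4]; ring
  · have h4 : ENNReal.ofReal ((r ^ m)⁻¹) * ENNReal.ofReal (r ^ m) = 1 := by
      rw [← ENNReal.ofReal_mul (by positivity), inv_mul_cancel₀ hrm.ne', ENNReal.ofReal_one]
    have h5 : ∫⁻ u, (c⁻¹ * ENNReal.ofReal ((r ^ m)⁻¹) * g (r⁻¹ • (u - b))) ^ 2 =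
        (c⁻¹ * ENNReal.ofReal ((r ^ m)⁻¹)) ^ 2 * (ENNReal.ofReal (r ^ m) * ∫⁻ v, g v ^ 2) := by
      rw [← lintegral_scale hr b _ (hg.pow_const 2), ← lintegral_const_mul _
        (show Measurable fun u => g (r⁻¹ • (u - b)) ^ 2 from (hg.pow_const 2).comp hSm)]
      refine lintegral_congr fun u => by rw [mul_pow]
    rw [h5]
    calc _ = c⁻¹ ^ 2 * ENNReal.ofReal ((r ^ m)⁻¹) *
          (ENNReal.ofReal ((r ^ m)⁻¹) * ENNReal.ofReal (r ^ m)) * ∫⁻ v, g v ^ 2 := by ring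
      _ = c⁻¹ ^ 2 * ENNReal.ofReal ((r ^ m)⁻¹) * ∫⁻ v, g v ^ 2 := by rw [h4, mul_one]
      _ ≤ _ := by gcongr

theorem HasL2.mono {m : ℕ} {ν : Measure (EuclideanSpace ℝ (Fin m))} {K K' : ℝ≥0∞}
    (h : HasL2 ν K) (hK : K ≤ K') : HasL2 ν K' := by
  obtain ⟨g, h1, h2, h3⟩ := h
  exact ⟨g, h1, h2, h3.trans hK⟩

theorem HasL2.ac {m : ℕ} {ν : Measure (EuclideanSpace ℝ (Fin m))} {K : ℝ≥0∞}
    (h : HasL2 ν K) : ν ≪ volume := by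
  obtain ⟨g, h1, h2, h3⟩ := h
  rw [h2]
  exact withDensity_absolutelyContinuous _ _

/-- Scaled estimate. -/
theorem step2 {n m : ℕ} {s : ℝ} (hs : 0 < s)
    {Λ : Type*} [MetricSpace Λ] [CompactSpace Λ] [MeasurableSpace Λ] [BorelSpace Λ]
    {ω : Measure Λ} [IsFiniteMeasure ω]
    {P : Λ → (EuclideanSpace ℝ (Fin n) →ₗ[ℝ] EuclideanSpace ℝ (Fin m))}
    (hP : ∀ l, IsOrthoProj (P l)) (hPcont : ∀ x, Continuous fun l => P l x)
    {C : ℝ} (hC : 0 < C) (hmain : MainHyp s ω P C)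
    (μ : Measure (EuclideanSpace ℝ (Fin n))) [IsFiniteMeasure μ] {M : ℝ} (hM : 0 < M)
    (hfr : ∀ x r, 0 < r → μ (closedBall x r) ≤ ENNReal.ofReal (M * r ^ s))
    (a : EuclideanSpace ℝ (Fin n)) {r : ℝ} (hr : 0 < r) :
    ∃ G : Λ → ℝ≥0∞, Measurable G ∧
      ∫⁻ l, G l ∂ω ≤ ENNReal.ofReal (M ^ 2 * C * r ^ (2 * s - m)) ∧
      ∀ᵐ l ∂ω, HasL2 ((μ.restrict (closedBall a r)).map (P l)) (G l) := by
  set c : ℝ := (M * r ^ s)⁻¹ with hc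
  have hrs : 0 < r ^ s := Real.rpow_pos_of_pos hr s
  have hc0 : 0 < c := by positivity
  have hTm : Measurable (fun x : EuclideanSpace ℝ (Fin n) => r⁻¹ • (x - a)) := by fun_prop
  set μ' : Measure (EuclideanSpace ℝ (Fin n)) :=
    ENNReal.ofReal c • (μ.restrict (closedBall a r)).map (fun x => r⁻¹ • (x - a)) with hμ'
  have hfin : IsFiniteMeasure μ' := by
    rw [hμ']; exact Measure.smul_finite _ ENNReal.ofReal_ne_top
  have hnorm : ∀ x y : EuclideanSpace ℝ (Fin n), dist (r⁻¹ • (x - a)) y =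
      r⁻¹ * dist x (a + r • y) := by
    intro x y
    have h1 : r⁻¹ * ‖x - (a + r • y)‖ = ‖r⁻¹ • (x - (a + r • y))‖ := by
      rw [norm_smul, Real.norm_eq_abs, abs_of_pos (inv_pos.2 hr)]
    rw [dist_eq_norm, dist_eq_norm, h1]
    congr 1
    rw [← sub_sub, smul_sub _ _ (r • y), smul_smul, inv_mul_cancel₀ hr.ne', one_smul]
  have hsup : μ' (closedBall 0 1)ᶜ = 0 := by
    rw [hμ', Measure.smul_apply, Measure.map_apply hTm measurableSet_closedBall.compl,
      Measure.restrict_apply (hTm measurableSet_closedBall.compl)]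
    have : (fun x => r⁻¹ • (x - a)) ⁻¹' (closedBall 0 1)ᶜ ∩ closedBall a r = ∅ := by
      ext x
      simp only [Set.mem_inter_iff, Set.mem_preimage, Set.mem_compl_iff, mem_closedBall, hnorm,
        Set.mem_empty_iff_false, iff_false, not_and, not_not, smul_zero, add_zero]
      intro h1 h2
      exact h1 (by rw [inv_mul_le_iff₀ hr]; linarith)
    rw [this]; simp
  have hfr' : ∀ x r, 0 < r → μ' (closedBall x r) ≤ ENNReal.ofReal (r ^ s) := by
    intro x ρ hρ
    rw [hμ', Measure.smul_apply, Measure.map_apply hTm measurableSet_closedBall]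
    have : (fun x => r⁻¹ • (x - a)) ⁻¹' (closedBall x ρ) = closedBall (a + r • x) (r * ρ) := by
      ext y
      simp only [Set.mem_preimage, mem_closedBall, hnorm]
      rw [inv_mul_le_iff₀ hr]
    rw [this, smul_eq_mul]
    calc ENNReal.ofReal c * (μ.restrict (closedBall a r)) (closedBall (a + r • x) (r * ρ))
        ≤ ENNReal.ofReal c * ENNReal.ofReal (M * (r * ρ) ^ s) := by
          gcongr
          exact (Measure.restrict_apply_le _ _).trans (hfr _ _ (by positivity))
      _ = ENNReal.ofReal (ρ ^ s) := by
          rw [← ENNReal.ofReal_mul hc0.le]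
          congr 1
          rw [hc, Real.mul_rpow hr.le hρ.le]
          field_simp
  obtain ⟨G, hGm, hGi, hG⟩ := step1 hP hPcont hmain μ' hsup hfr'
  · refine ⟨fun l => (ENNReal.ofReal c)⁻¹ ^ 2 * ENNReal.ofReal ((r ^ m)⁻¹) * G l,
      hGm.const_mul _, ?_, ?_⟩
    · rw [lintegral_const_mul _ hGm]
      refine (mul_le_mul_right hGi _).trans (le_of_eq ?_)
      rw [← ENNReal.ofReal_inv_of_pos hc0, ← ENNReal.ofReal_pow (by positivity),
        ← ENNReal.ofReal_mul (by positivity), ← ENNReal.ofReal_mul (by positivity)]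
      congr 1
      rw [hc, inv_inv, Real.rpow_sub hr, two_mul, Real.rpow_add hr, Real.rpow_natCast]
      field_simp
    · filter_upwards [hG] with l hl
      refine HasL2.scale hr (P l a) (by simpa using hc0) ENNReal.ofReal_ne_top ?_
      convert hl using 1
      rw [hμ', Measure.map_smul, Measure.map_map (proj_cont _).measurable hTm,
        Measure.map_map (by fun_prop) (proj_cont _).measurable]
      congr 2
      funext x
      simp

theorem upper_density_null {n : ℕ} {s : ℝ} (hs : 0 < s)
    (ν : Measure (EuclideanSpace ℝ (Fin n))) [IsFiniteMeasure ν] :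
    μH[s] {x : EuclideanSpace ℝ (Fin n) | ∀ M : ℕ, ∃ r : ℝ, 0 < r ∧
      ENNReal.ofReal (((M : ℝ) + 1) * r ^ s) < ν (closedBall x r)} = 0 := by
  set D := {x : EuclideanSpace ℝ (Fin n) | ∀ M : ℕ, ∃ r : ℝ, 0 < r ∧
      ENNReal.ofReal (((M : ℝ) + 1) * r ^ s) < ν (closedBall x r)} with hD
  set W : ℝ := ν.real Set.univ with hW
  have hW0 : 0 ≤ W := measureReal_nonneg
  have hνW : ∀ S, ν S ≤ ENNReal.ofReal W := fun S => by
    rw [hW, ofReal_measureReal]; exact measure_mono (Set.subset_univ _)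
  -- for each M a cover
  have hcov : ∀ M : ℕ, ∃ (u : Set (EuclideanSpace ℝ (Fin n)))
      (r : EuclideanSpace ℝ (Fin n) → ℝ), u.Countable ∧ (∀ x ∈ u, 0 < r x) ∧
      D ⊆ (⋃ x : u, closedBall (x : EuclideanSpace ℝ (Fin n)) (5 * r x)) ∧
      (∀ x ∈ u, r x ≤ (W / ((M : ℝ) + 1)) ^ (1 / s)) ∧
      ∑' x : u, ENNReal.ofReal (r x ^ s) ≤ ENNReal.ofReal (W / ((M : ℝ) + 1)) := by
    intro M
    have hM1 : (0 : ℝ) < (M : ℝ) + 1 := by positivity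
    have h1 : ∀ x : EuclideanSpace ℝ (Fin n), ∃ r : ℝ, x ∈ D → (0 < r ∧
      ENNReal.ofReal (((M : ℝ) + 1) * r ^ s) < ν (closedBall x r)) := by
      intro x
      by_cases hx : x ∈ D
      · obtain ⟨r, hr⟩ := hx M
        exact ⟨r, fun _ => hr⟩
      · exact ⟨0, fun h => absurd h hx⟩
    choose r hr using h1
    have hrb : ∀ x ∈ D, r x ≤ (W / ((M : ℝ) + 1)) ^ (1 / s) := by
      intro x hx
      obtain ⟨h2, h3⟩ := hr x hx
      have h4 := (ENNReal.ofReal_lt_ofReal_iff_of_nonneg (by positivity)).1 (h3.trans_le (hνW _))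
      have h5 : r x ^ s ≤ W / ((M : ℝ) + 1) := by
        rw [le_div_iff₀ hM1]; linarith
      calc r x = (r x ^ s) ^ (1 / s) := by
            rw [← Real.rpow_mul h2.le, mul_one_div_cancel hs.ne', Real.rpow_one]
        _ ≤ _ := Real.rpow_le_rpow (by positivity) h5 (by positivity)
    obtain ⟨u, huD, hdis, hu⟩ := Vitali.exists_disjoint_subfamily_covering_enlargement_closedBall
      D id r _ hrb 5 (by norm_num)
    have huc : u.Countable := by
      refine hdis.countable_of_nonempty_interior fun x hx => ?_
      exact ⟨x, ball_subset_interior_closedBall (mem_ball_self (hr x (huD hx)).1)⟩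
    refine ⟨u, r, huc, fun x hx => (hr x (huD hx)).1, ?_, fun x hx => hrb x (huD hx), ?_⟩
    · intro x hx
      obtain ⟨b, hb, hxb⟩ := hu x hx
      exact Set.mem_iUnion.2 ⟨⟨b, hb⟩, hxb (mem_closedBall_self (hr x hx).1.le)⟩
    · have : Countable u := huc.to_subtype
      have h2 : ∑' x : u, ν (closedBall (x : EuclideanSpace ℝ (Fin n)) (r x)) ≤
          ENNReal.ofReal W := by
        rw [← measure_iUnion]
        · exact hνW _
        · intro x y hxy
          exact hdis x.2 y.2 (fun h => hxy (Subtype.ext h))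
        · exact fun x => measurableSet_closedBall
      have h3 : ENNReal.ofReal ((M : ℝ) + 1) * ∑' x : u, ENNReal.ofReal (r x ^ s) ≤
          ENNReal.ofReal W := by
        rw [← ENNReal.tsum_mul_left]
        refine le_trans (ENNReal.tsum_le_tsum fun x => ?_) h2
        rw [← ENNReal.ofReal_mul hM1.le]
        exact (hr x (huD x.2)).2.le
      rw [ENNReal.ofReal_div_of_pos hM1, ENNReal.le_div_iff_mul_le (by simp [hM1]) (by simp),
        mul_comm]
      exact h3
  choose u r huc hr0 hcov hrb hsum using hcov
  have hcount : ∀ M, Countable (u M) := fun M => (huc M).to_subtype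
  have hlim : Tendsto (fun M : ℕ => W / ((M : ℝ) + 1)) atTop (𝓝 0) := by
    simpa [div_eq_mul_inv] using (tendsto_one_div_add_atTop_nhds_zero_nat (𝕜 := ℝ)).const_mul W
  have hdiam : ∀ M (x : u M), ediam (closedBall (x : EuclideanSpace ℝ (Fin n)) (5 * r M x)) ≤
      ENNReal.ofReal (10 * r M x) := by
    intro M x
    have h0 := hr0 M x x.2
    refine (ediam_le_of_forall_dist_le (C := 10 * r M x) fun y hy z hz => ?_)
    have := dist_triangle_right y z (x : EuclideanSpace ℝ (Fin n))
    rw [mem_closedBall] at hy hz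
    linarith
  have key := Measure.hausdorffMeasure_le_liminf_tsum s D (l := atTop)
    (fun M : ℕ => ENNReal.ofReal (10 * (W / ((M : ℝ) + 1)) ^ (1 / s))) ?_
    (fun M (x : u M) => closedBall (x : EuclideanSpace ℝ (Fin n)) (5 * r M x))
    (Eventually.of_forall fun M x => (hdiam M x).trans
      (ENNReal.ofReal_le_ofReal (by linarith [hrb M x x.2])))
    (Eventually.of_forall fun M => hcov M)
  · refine le_antisymm (key.trans ?_) zero_le
    have h1 : ∀ M : ℕ, ∑' x : u M, ediam (closedBall (x : EuclideanSpace ℝ (Fin n))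
        (5 * r M x)) ^ s ≤ ENNReal.ofReal (10 ^ s * (W / ((M : ℝ) + 1))) := by
      intro M
      rw [ENNReal.ofReal_mul (by positivity)]
      refine le_trans ?_ (mul_le_mul_right (hsum M) _)
      rw [← ENNReal.tsum_mul_left]
      refine ENNReal.tsum_le_tsum fun x => ?_
      have h0 := hr0 M x x.2
      rw [← ENNReal.ofReal_mul (by positivity), ← Real.mul_rpow (by norm_num) h0.le,
        ← ENNReal.ofReal_rpow_of_nonneg (by positivity) hs.le]
      exact ENNReal.rpow_le_rpow (hdiam M x) hs.le
    have h2 : Tendsto (fun M : ℕ => ENNReal.ofReal (10 ^ s * (W / ((M : ℝ) + 1)))) atTop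
        (𝓝 0) := by
      have := ENNReal.tendsto_ofReal (hlim.const_mul (10 ^ s))
      simpa using this
    rw [← h2.liminf_eq]
    exact liminf_le_liminf (Eventually.of_forall h1)
  · have h3 := (hlim.rpow_const (p := 1 / s) (Or.inr (by positivity))).const_mul 10
    rw [Real.zero_rpow (by positivity), mul_zero] at h3
    simpa using ENNReal.tendsto_ofReal h3

theorem measurable_closedBall_measure {n : ℕ}
    (ν : Measure (EuclideanSpace ℝ (Fin n))) [IsFiniteMeasure ν] (q : ℝ) :
    Measurable fun x => ν (closedBall x q) := by
  have hcl : IsClosed {z : EuclideanSpace ℝ (Fin n) × EuclideanSpace ℝ (Fin n) |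
      dist z.2 z.1 ≤ q} := isClosed_le (by fun_prop) continuous_const
  exact measurable_measure_prodMk_left hcl.measurableSet

/-- Frostman pieces -/
def FrSet {n : ℕ} (s : ℝ) (ν : Measure (EuclideanSpace ℝ (Fin n))) (M : ℕ) :
    Set (EuclideanSpace ℝ (Fin n)) :=
  {x | ∀ q : ℚ, 0 < q → ν (closedBall x q) ≤ ENNReal.ofReal (((M : ℝ) + 1) * (q : ℝ) ^ s)}

/-- lower density pieces -/
def LoSet {n : ℕ} (s : ℝ) (ν : Measure (EuclideanSpace ℝ (Fin n))) (M : ℕ) :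
    Set (EuclideanSpace ℝ (Fin n)) :=
  {x | ∀ q : ℚ, 0 < q → (q : ℝ) < 1 / ((M : ℝ) + 1) →
    ENNReal.ofReal ((q : ℝ) ^ s / ((M : ℝ) + 1)) ≤ ν (closedBall x q)}

theorem FrSet.measurableSet {n : ℕ} (s : ℝ) (ν : Measure (EuclideanSpace ℝ (Fin n)))
    [IsFiniteMeasure ν] (M : ℕ) : MeasurableSet (FrSet s ν M) := by
  unfold FrSet
  simp only [Set.ofPred_forall]
  exact MeasurableSet.iInter fun q => MeasurableSet.iInter fun _ =>
    measurableSet_le (measurable_closedBall_measure ν q) measurable_const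

theorem LoSet.measurableSet {n : ℕ} (s : ℝ) (ν : Measure (EuclideanSpace ℝ (Fin n)))
    [IsFiniteMeasure ν] (M : ℕ) : MeasurableSet (LoSet s ν M) := by
  unfold LoSet
  simp only [Set.ofPred_forall]
  exact MeasurableSet.iInter fun q => MeasurableSet.iInter fun _ => MeasurableSet.iInter fun _ =>
    measurableSet_le measurable_const (measurable_closedBall_measure ν q)

theorem FrSet.null {n : ℕ} {s : ℝ} (hs : 0 < s) (A : Set (EuclideanSpace ℝ (Fin n)))
    [IsFiniteMeasure ((μH[s] : Measure (EuclideanSpace ℝ (Fin n))).restrict A)] :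
    ∀ᵐ x ∂((μH[s] : Measure (EuclideanSpace ℝ (Fin n))).restrict A),
      ∃ M, x ∈ FrSet s (μH[s].restrict A) M := by
  have h := upper_density_null hs ((μH[s] : Measure (EuclideanSpace ℝ (Fin n))).restrict A)
  have h' := Measure.absolutelyContinuous_of_le
    (Measure.restrict_le_self (μ := (μH[s] : Measure (EuclideanSpace ℝ (Fin n)))) (s := A)) h
  have h2 := measure_eq_zero_iff_ae_notMem.1 h'
  filter_upwards [h2] with x hx
  simp only [not_forall, not_exists, not_and, not_lt] at hx
  obtain ⟨M, hM⟩ := hx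
  exact ⟨M, fun q hq => hM q (by exact_mod_cast hq)⟩

theorem FrSet.bound {n : ℕ} {s : ℝ} (hs : 0 < s) {ν : Measure (EuclideanSpace ℝ (Fin n))}
    {M : ℕ} {S : Set (EuclideanSpace ℝ (Fin n))} (hS : MeasurableSet S) (hSM : S ⊆ FrSet s ν M)
    (x : EuclideanSpace ℝ (Fin n)) (r : ℝ) (hr : 0 < r) :
    (ν.restrict S) (closedBall x r) ≤ ENNReal.ofReal ((((M : ℝ) + 1) * 4 ^ s) * r ^ s) := by
  rw [Measure.restrict_apply measurableSet_closedBall]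
  rcases (closedBall x r ∩ S).eq_empty_or_nonempty with he | ⟨y, hy1, hy2⟩
  · rw [he]; simp
  obtain ⟨q, hq1, hq2⟩ := exists_rat_btwn (show 2 * r < 4 * r by linarith)
  have hq0 : (0 : ℝ) < q := by linarith
  calc ν (closedBall x r ∩ S) ≤ ν (closedBall y q) := by
        refine measure_mono fun z hz => ?_
        have h1 := hz.1
        rw [mem_closedBall] at h1 hy1 ⊢
        have := dist_triangle_right z y x
        linarith
    _ ≤ ENNReal.ofReal (((M : ℝ) + 1) * (q : ℝ) ^ s) := hSM hy2 q (by exact_mod_cast hq0)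
    _ ≤ _ := by
        apply ENNReal.ofReal_le_ofReal
        rw [mul_assoc, ← Real.mul_rpow (by norm_num) hr.le]
        gcongr

theorem LoSet.null {n : ℕ} {s : ℝ} (hs : 0 < s) (A : Set (EuclideanSpace ℝ (Fin n)))
    (hld : ∀ᵐ x ∂(μH[s].restrict A), 0 < lowerDensity s A x) :
    ∀ᵐ x ∂((μH[s] : Measure (EuclideanSpace ℝ (Fin n))).restrict A),
      ∃ M, x ∈ LoSet s (μH[s].restrict A) M := by
  filter_upwards [hld] with x hx
  unfold lowerDensity at hx
  obtain ⟨c, hc0, hc⟩ := exists_between hx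
  have h1 := Filter.eventually_lt_of_lt_liminf hc
  rw [eventually_nhdsWithin_iff] at h1
  obtain ⟨ε, hε, h2⟩ := Metric.eventually_nhds_iff.1 h1
  obtain ⟨M1, hM1⟩ := exists_nat_gt (1 / ε)
  obtain ⟨M2, hM2⟩ := ENNReal.exists_inv_nat_lt hc0.ne'
  refine ⟨max M1 M2, fun q hq hqM => ?_⟩
  have hq0 : (0 : ℝ) < q := by exact_mod_cast hq
  have hm1 : (M1 : ℝ) ≤ ((max M1 M2 : ℕ) : ℝ) := by exact_mod_cast le_max_left _ _
  have hqε : (q : ℝ) < ε := by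
    refine hqM.trans ?_
    rw [div_lt_iff₀ (by positivity)]
    rw [div_lt_iff₀ hε] at hM1
    nlinarith
  have h3 := h2 (y := (q : ℝ)) (by rwa [Real.dist_eq, sub_zero, abs_of_pos hq0]) hq0
  rw [Measure.restrict_apply measurableSet_closedBall, Set.inter_comm]
  have h4 : c * ENNReal.ofReal ((2 * (q : ℝ)) ^ s) ≤ μH[s] (A ∩ closedBall x q) :=
    ENNReal.mul_le_of_le_div h3.le
  refine le_trans ?_ h4
  rw [div_eq_mul_inv, mul_comm, ENNReal.ofReal_mul (by positivity)]
  refine mul_le_mul' (le_trans ?_ hM2.le) (ENNReal.ofReal_le_ofReal ?_)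
  · rw [ENNReal.ofReal_inv_of_pos (by positivity), ENNReal.inv_le_inv]
    rw [← ENNReal.ofReal_natCast]
    apply ENNReal.ofReal_le_ofReal
    have : (M2 : ℝ) ≤ ((max M1 M2 : ℕ) : ℝ) := by exact_mod_cast le_max_right _ _
    linarith
  · gcongr; linarith

theorem LoSet.bound {n : ℕ} {s : ℝ} (hs : 0 < s) {ν : Measure (EuclideanSpace ℝ (Fin n))}
    (M : ℕ) : ∃ c : ℝ, 0 < c ∧ ∀ x ∈ LoSet s ν M, ∀ r : ℝ, 0 < r → r ≤ 1 →
      ENNReal.ofReal (c * r ^ s) ≤ ν (closedBall x r) := by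
  set d : ℝ := 1 / ((M : ℝ) + 1) with hd
  have hd0 : 0 < d := by positivity
  have hd1 : d ≤ 1 := by
    rw [hd, div_le_one (by positivity)]
    have : (0 : ℝ) ≤ M := by positivity
    linarith
  refine ⟨(d / 2) ^ s * d, by positivity, fun x hx r hr hr1 => ?_⟩
  obtain ⟨q, hq1, hq2⟩ := exists_rat_btwn (show r * (d / 2) < r * d by nlinarith)
  have hq0 : (0 : ℝ) < q := lt_trans (by positivity) hq1
  have hqd : (q : ℝ) < d := by nlinarith
  have hqr : (q : ℝ) < r := by nlinarith
  refine le_trans ?_ ((hx q (by exact_mod_cast hq0) hqd).trans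
    (measure_mono (closedBall_subset_closedBall hqr.le)))
  apply ENNReal.ofReal_le_ofReal
  calc (d / 2) ^ s * d * r ^ s = (r * (d / 2)) ^ s * d := by
        rw [Real.mul_rpow hr.le (by positivity)]; ring
    _ ≤ (q : ℝ) ^ s * d := by gcongr
    _ = _ := by rw [hd]; ring

/-- Covering by few balls -/
theorem cover_count {n : ℕ} {s : ℝ} {ν : Measure (EuclideanSpace ℝ (Fin n))}
    [IsFiniteMeasure ν] {c : ℝ} (hc : 0 < c) {K : Set (EuclideanSpace ℝ (Fin n))}
    (hK : ∀ x ∈ K, ∀ r : ℝ, 0 < r → r ≤ 1 → ENNReal.ofReal (c * r ^ s) ≤ ν (closedBall x r))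
    {ρ : ℝ} (hρ : 0 < ρ) (hρ1 : ρ ≤ 1) :
    ∃ T : Finset (EuclideanSpace ℝ (Fin n)), K ⊆ (⋃ a ∈ T, closedBall a ρ) ∧
      (T.card : ℝ) ≤ ν.real Set.univ * 4 ^ s / c * (ρ ^ s)⁻¹ := by
  obtain ⟨u, huK, hdis, hu⟩ := Vitali.exists_disjoint_subfamily_covering_enlargement_closedBall
      K id (fun _ => ρ / 4) (ρ / 4) (fun _ _ => le_rfl) 4 (by norm_num)
  have hb : ∀ T : Finset (EuclideanSpace ℝ (Fin n)), (T : Set _) ⊆ u →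
      (T.card : ℝ) ≤ ν.real Set.univ * 4 ^ s / c * (ρ ^ s)⁻¹ := by
    intro T hT
    have h1 : ∑ a ∈ T, ν (closedBall a (ρ / 4)) ≤ ν Set.univ := by
      rw [← measure_biUnion_finset]
      · exact measure_mono (Set.subset_univ _)
      · exact fun a ha b hb hab => hdis (hT ha) (hT hb) hab
      · exact fun _ _ => measurableSet_closedBall
    have h2 : ∑ a ∈ T, ENNReal.ofReal (c * (ρ / 4) ^ s) ≤ ν Set.univ :=
      le_trans (Finset.sum_le_sum fun a ha => hK a (huK (hT ha)) _ (by positivity) (by linarith)) h1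
    rw [Finset.sum_const, ← ofReal_measureReal, ← ENNReal.ofReal_nsmul,
      ENNReal.ofReal_le_ofReal_iff measureReal_nonneg, Real.div_rpow hρ.le (by norm_num),
      nsmul_eq_mul] at h2
    have hρs : 0 < ρ ^ s := Real.rpow_pos_of_pos hρ s
    have h4s : (0 : ℝ) < 4 ^ s := by positivity
    have h3 : (T.card : ℝ) * (c * (ρ ^ s / 4 ^ s)) * (4 ^ s / (c * ρ ^ s)) ≤
        ν.real Set.univ * (4 ^ s / (c * ρ ^ s)) := by gcongr
    have e1 : (T.card : ℝ) * (c * (ρ ^ s / 4 ^ s)) * (4 ^ s / (c * ρ ^ s)) = T.card := by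
      field_simp
    rw [e1] at h3
    refine h3.trans (le_of_eq ?_)
    field_simp
  have hfin : u.Finite := by
    by_contra hinf
    obtain ⟨N, hN⟩ := exists_nat_gt (ν.real Set.univ * 4 ^ s / c * (ρ ^ s)⁻¹)
    obtain ⟨T, hT, hcard⟩ := Set.Infinite.exists_subset_card_eq hinf N
    have := hb T hT
    rw [hcard] at this
    linarith
  refine ⟨hfin.toFinset, fun x hx => ?_, hb _ (by simp)⟩
  obtain ⟨b, hbu, hxb⟩ := hu x hx
  simp only [Set.mem_iUnion]
  refine ⟨b, by simpa using hbu, ?_⟩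
  have := hxb (mem_closedBall_self (by positivity))
  simpa [mul_div_cancel₀] using this

theorem cs_ennreal {ι : Type*} (J : Finset ι) (w g : ι → ℝ≥0∞) (hw0 : ∀ p, w p ≠ 0)
    (hw : ∀ p, w p ≠ ∞) :
    (∑ p ∈ J, g p) ^ 2 ≤ (∑ p ∈ J, w p) * ∑ p ∈ J, (w p)⁻¹ * g p ^ 2 := by
  have h := ENNReal.inner_le_Lp_mul_Lq J (fun p => w p ^ (1 / 2 : ℝ))
    (fun p => w p ^ (-(1 / 2) : ℝ) * g p) (p := 2) (q := 2) Real.HolderConjugate.two_two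
  have e1 : ∀ p, w p ^ (1 / 2 : ℝ) * (w p ^ (-(1 / 2) : ℝ) * g p) = g p := fun p => by
    rw [← mul_assoc, ← ENNReal.rpow_add _ _ (hw0 p) (hw p)]; simp
  have e2 : ∀ p, (w p ^ (1 / 2 : ℝ)) ^ (2 : ℝ) = w p := fun p => by
    rw [← ENNReal.rpow_mul]; norm_num
  have e3 : ∀ p, (w p ^ (-(1 / 2) : ℝ) * g p) ^ (2 : ℝ) = (w p)⁻¹ * g p ^ 2 := fun p => by
    rw [ENNReal.mul_rpow_of_nonneg _ _ (by norm_num), ← ENNReal.rpow_mul, ← ENNReal.rpow_neg_one]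
    norm_num
  simp only [e1, e2, e3] at h
  have h2 := pow_le_pow_left' h 2
  refine h2.trans (le_of_eq ?_)
  have e4 : ∀ a : ℝ≥0∞, (a ^ (1 / 2 : ℝ)) ^ 2 = a := fun a => by
    rw [← ENNReal.rpow_natCast, ← ENNReal.rpow_mul]; norm_num
  rw [mul_pow, e4, e4]

theorem bad_null {n m : ℕ} {ι : Type*} [Countable ι]
    {μ : Measure (EuclideanSpace ℝ (Fin n))} [IsFiniteMeasure μ]
    {K : Set (EuclideanSpace ℝ (Fin n))} (hK : IsCompact K) (hμK : μ Kᶜ = 0)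
    {Q : EuclideanSpace ℝ (Fin n) → EuclideanSpace ℝ (Fin m)} (hQ : Continuous Q)
    {V B : ι → Set (EuclideanSpace ℝ (Fin n))} (hV : ∀ p, IsOpen (V p)) (hVB : ∀ p, V p ⊆ B p)
    {w : ι → ℝ≥0∞} (hw0 : ∀ p, w p ≠ 0) (hw : ∀ p, w p ≠ ∞)
    {G : ι → ℝ≥0∞} (hG : ∀ p, HasL2 ((μ.restrict (B p)).map Q) (G p))
    (hsum : ∑' p, (w p)⁻¹ * G p ≠ ∞) (hac : μ.map Q ≪ volume) :
    (μ.map Q) {u | ∀ N : ℕ, ∃ J : Finset ι, (∀ x ∈ K, Q x = u → ∃ p ∈ J, x ∈ V p) ∧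
      ∑ p ∈ J, w p ≤ ((N : ℝ≥0∞) + 1)⁻¹} = 0 := by
  choose g hgm hgd hgi using hG
  set h := (μ.map Q).rnDeriv volume with hh
  have hhm : Measurable h := Measure.measurable_rnDeriv _ _
  have hhd : volume.withDensity h = μ.map Q := Measure.withDensity_rnDeriv_eq _ _ hac
  have hle : ∀ J : Finset ι, ∀ᵐ u, (∀ x ∈ K, Q x = u → ∃ p ∈ J, x ∈ V p) →
      h u ≤ ∑ p ∈ J, g p u := by
    intro J
    set O : Set (EuclideanSpace ℝ (Fin m)) := {u | ∀ x ∈ K, Q x = u → ∃ p ∈ J, x ∈ V p} with hO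
    have hOm : MeasurableSet O := by
      have h1 : Oᶜ = Q '' (K \ ⋃ p ∈ J, V p) := by
        ext u
        simp only [hO, Set.mem_compl_iff, Set.mem_image, Set.mem_diff, Set.mem_iUnion]
        constructor
        · intro hu
          by_contra hcon
          refine hu fun x hx hxu => ?_
          by_contra hc
          exact hcon ⟨x, ⟨hx, by simpa using hc⟩, hxu⟩
        · rintro ⟨x, ⟨hx, hx2⟩, rfl⟩ hu
          obtain ⟨p, hp, hxp⟩ := hu x hx rfl
          exact hx2 ⟨p, hp, hxp⟩
      have h2 : IsCompact (K \ ⋃ p ∈ J, V p) :=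
        hK.diff (isOpen_biUnion fun p _ => hV p)
      rw [← MeasurableSet.compl_iff, h1]
      exact (h2.image hQ).measurableSet
    have h1 : h ≤ᵐ[volume.restrict O] fun u => ∑ p ∈ J, g p u := by
      refine ae_le_of_forall_setLIntegral_le_of_sigmaFinite hhm fun S hS _ => ?_
      have hSO : MeasurableSet (S ∩ O) := hS.inter hOm
      rw [Measure.restrict_restrict hS, lintegral_finsetSum _ fun p _ => hgm p,
        ← withDensity_apply _ hSO, hhd, Measure.map_apply hQ.measurable hSO]
      have h2 : ∀ p, ∫⁻ u in S ∩ O, g p u = μ (Q ⁻¹' (S ∩ O) ∩ B p) := by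
        intro p
        rw [← withDensity_apply _ hSO, ← hgd p, Measure.map_apply hQ.measurable hSO,
          Measure.restrict_apply (hQ.measurable hSO)]
      simp only [h2]
      refine le_trans ?_ (measure_biUnion_finset_le J _)
      refine measure_mono_ae ?_
      filter_upwards [measure_eq_zero_iff_ae_notMem.1 hμK] with x hxK hx
      have hxK' : x ∈ K := by simpa using hxK
      obtain ⟨p, hp, hxp⟩ := hx.2 x hxK' rfl
      exact Set.mem_biUnion (x := p) hp ⟨hx, hVB p hxp⟩
    exact (ae_restrict_iff' hOm).1 h1
  have hFm : Measurable fun u => ∑' p, (w p)⁻¹ * g p u ^ 2 :=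
    Measurable.tsum fun p => ((hgm p).pow_const 2).const_mul _
  have hFi : ∫⁻ u, ∑' p, (w p)⁻¹ * g p u ^ 2 ≠ ∞ := by
    rw [lintegral_tsum fun p => (((hgm p).pow_const 2).const_mul _).aemeasurable]
    refine ne_top_of_le_ne_top hsum (ENNReal.tsum_le_tsum fun p => ?_)
    rw [lintegral_const_mul _ ((hgm p).pow_const 2)]
    gcongr
    exact hgi p
  have hF := ae_lt_top hFm hFi
  rw [← hhd, withDensity_apply_eq_zero' hhm.aemeasurable, measure_eq_zero_iff_ae_notMem]
  filter_upwards [hF, ae_all_iff.2 hle] with u hFu hu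
  rintro ⟨hu0, hubad⟩
  apply hu0
  have h3 : ∀ N : ℕ, h u ^ 2 ≤ ((N : ℝ≥0∞) + 1)⁻¹ * ∑' p, (w p)⁻¹ * g p u ^ 2 := by
    intro N
    obtain ⟨J, hJ1, hJ2⟩ := hubad N
    calc h u ^ 2 ≤ (∑ p ∈ J, g p u) ^ 2 := pow_le_pow_left' (hu J hJ1) 2
      _ ≤ (∑ p ∈ J, w p) * ∑ p ∈ J, (w p)⁻¹ * g p u ^ 2 := cs_ennreal J w _ hw0 hw
      _ ≤ _ := mul_le_mul' hJ2 (ENNReal.sum_le_tsum J)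
  have h4 : Tendsto (fun N : ℕ => ((N : ℝ≥0∞) + 1)⁻¹ * ∑' p, (w p)⁻¹ * g p u ^ 2) atTop
      (𝓝 (0 * ∑' p, (w p)⁻¹ * g p u ^ 2)) := by
    refine ENNReal.Tendsto.mul_const ?_ (Or.inr hFu.ne)
    have := (tendsto_add_atTop_iff_nat 1).2 ENNReal.tendsto_inv_nat_nhds_zero
    simpa using this
  rw [zero_mul] at h4
  have h5 : h u ^ 2 ≤ 0 := ge_of_tendsto' h4 h3
  simpa using h5

theorem bad_joint {n m : ℕ} {Λ : Type*} [MetricSpace Λ] [CompactSpace Λ] [MeasurableSpace Λ]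
    [BorelSpace Λ]
    {P : Λ → (EuclideanSpace ℝ (Fin n) →ₗ[ℝ] EuclideanSpace ℝ (Fin m))}
    (hP : ∀ l, IsOrthoProj (P l)) (hPcont : ∀ x, Continuous fun l => P l x)
    {ι : Type*} [Countable ι]
    {K : Set (EuclideanSpace ℝ (Fin n))} (hK : IsCompact K)
    {V : ι → Set (EuclideanSpace ℝ (Fin n))} (hV : ∀ p, IsOpen (V p))
    (w : ι → ℝ≥0∞) :
    MeasurableSet {q : EuclideanSpace ℝ (Fin n) × Λ | ∀ N : ℕ, ∃ J : Finset ι,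
      (∀ x ∈ K, P q.2 x = P q.2 q.1 → ∃ p ∈ J, x ∈ V p) ∧
      ∑ p ∈ J, w p ≤ ((N : ℝ≥0∞) + 1)⁻¹} := by
  have hopen : ∀ J : Finset ι, IsOpen {q : EuclideanSpace ℝ (Fin n) × Λ |
      ∀ x ∈ K, P q.2 x = P q.2 q.1 → ∃ p ∈ J, x ∈ V p} := by
    intro J
    set L : Set (EuclideanSpace ℝ (Fin n)) := K \ ⋃ p ∈ J, V p with hL
    have hLc : IsCompact L := hK.diff (isOpen_biUnion fun p _ => hV p)
    have : CompactSpace L := isCompact_iff_compactSpace.1 hLc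
    have hcl : IsClosed {z : L × (EuclideanSpace ℝ (Fin n) × Λ) |
        P z.2.2 z.1 = P z.2.2 z.2.1} := by
      refine isClosed_eq ?_ ?_
      · exact (joint_cont hP hPcont).comp
          (g := fun q : EuclideanSpace ℝ (Fin n) × Λ => P q.2 q.1)
          (f := fun z : L × (EuclideanSpace ℝ (Fin n) × Λ) => ((z.1 : EuclideanSpace ℝ (Fin n)),
            z.2.2)) (by fun_prop)
      · exact (joint_cont hP hPcont).comp
          (g := fun q : EuclideanSpace ℝ (Fin n) × Λ => P q.2 q.1)
          (f := fun z : L × (EuclideanSpace ℝ (Fin n) × Λ) => z.2) (by fun_prop)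
    have hcl2 := isClosedMap_snd_of_compactSpace _ hcl
    convert hcl2.isOpen_compl using 1
    ext q
    simp only [Set.mem_compl_iff, Set.mem_image, not_exists, not_and]
    constructor
    · rintro h ⟨⟨y, hy⟩, q'⟩ hyq rfl
      obtain ⟨p, hp, hyp⟩ := h y hy.1 hyq
      exact hy.2 (Set.mem_biUnion (x := p) hp hyp)
    · intro h x hx hxq
      by_contra hcon
      refine h (⟨x, hx, ?_⟩, q) hxq rfl
      simpa using hcon
  have : {q : EuclideanSpace ℝ (Fin n) × Λ | ∀ N : ℕ, ∃ J : Finset ι,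
      (∀ x ∈ K, P q.2 x = P q.2 q.1 → ∃ p ∈ J, x ∈ V p) ∧
      ∑ p ∈ J, w p ≤ ((N : ℝ≥0∞) + 1)⁻¹} = ⋂ N : ℕ, ⋃ J : Finset ι,
      ⋃ _ : ∑ p ∈ J, w p ≤ ((N : ℝ≥0∞) + 1)⁻¹, {q : EuclideanSpace ℝ (Fin n) × Λ |
      ∀ x ∈ K, P q.2 x = P q.2 q.1 → ∃ p ∈ J, x ∈ V p} := by
    ext q
    simp only [Set.mem_iInter, Set.mem_iUnion]
    constructor
    · intro h N
      obtain ⟨J, h1, h2⟩ := h N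
      exact ⟨J, h2, h1⟩
    · intro h N
      obtain ⟨J, h1, h2⟩ := h N
      exact ⟨J, h2, h1⟩
  rw [this]
  exact MeasurableSet.iInter fun N => MeasurableSet.iUnion fun J => MeasurableSet.iUnion fun _ =>
    (hopen J).measurableSet

theorem cover_small {n : ℕ} {t : ℝ} (ht : 0 < t) {K S : Set (EuclideanSpace ℝ (Fin n))}
    (hS : IsCompact S) (hSK : S ⊆ K) (hS0 : μH[t] S = 0)
    (T : ℕ → Finset (EuclideanSpace ℝ (Fin n)))
    (hT : ∀ k, K ⊆ ⋃ a ∈ T k, closedBall a ((1 / 2 : ℝ) ^ k)) {ε : ℝ≥0∞} (hε : ε ≠ 0) :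
    ∃ J : Finset (Σ k, T k), (∀ x ∈ S, ∃ p ∈ J,
        x ∈ ball (p.2 : EuclideanSpace ℝ (Fin n)) (2 * (1 / 2 : ℝ) ^ p.1)) ∧
      ∑ p ∈ J, ENNReal.ofReal (((1 / 2 : ℝ) ^ p.1) ^ t) ≤ ε := by
  classical
  rcases S.eq_empty_or_nonempty with he | ⟨x0, hx0⟩
  · exact ⟨∅, by simp [he], by simp⟩
  -- pick one ball
  have hpick : ∀ x ∈ S, ∀ d η : ℝ, 0 ≤ d → d ≤ 1 / 4 → 0 < η → ∃ p : (Σ k, T k),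
      closedBall x d ⊆ ball (p.2 : EuclideanSpace ℝ (Fin n)) (2 * (1 / 2 : ℝ) ^ p.1) ∧
      ENNReal.ofReal (((1 / 2 : ℝ) ^ p.1) ^ t) ≤
        ENNReal.ofReal (4 ^ t) * (ENNReal.ofReal (d ^ t) + ENNReal.ofReal η) := by
    intro x hx d η hd0 hd hη
    set η' : ℝ := min (1 / 4) (η ^ (1 / t)) with hη'
    have hη'0 : 0 < η' := by
      rw [hη']; exact lt_min (by norm_num) (by positivity)
    have hη't : η' ^ t ≤ η := by
      calc η' ^ t ≤ (η ^ (1 / t)) ^ t := by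
            gcongr; exact min_le_right _ _
        _ = η := by rw [← Real.rpow_mul hη.le, one_div_mul_cancel ht.ne', Real.rpow_one]
    set d' := max d η' with hd'
    have hd'0 : 0 < d' := lt_max_of_lt_right hη'0
    have hd'1 : d' ≤ 1 / 4 := max_le hd (min_le_left _ _)
    have hd't : d' ^ t ≤ d ^ t + η := by
      rcases max_choice d η' with h | h
      · rw [hd', h]; linarith
      · rw [hd', h]
        have := Real.rpow_nonneg hd0 t
        linarith
    obtain ⟨k, hk1, hk2⟩ := exists_nat_pow_near_of_lt_one (x := 2 * d') (y := (1 / 2 : ℝ))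
      (by positivity) (by linarith) (by norm_num) (by norm_num)
    have hxk := hT k (hSK hx)
    simp only [Set.mem_iUnion] at hxk
    obtain ⟨a, ha, hxa⟩ := hxk
    refine ⟨⟨k, a, ha⟩, fun y hy => ?_, ?_⟩
    · rw [mem_closedBall] at hxa hy
      rw [mem_ball]
      have := dist_triangle y x a
      have : d ≤ d' := le_max_left _ _
      simp only
      linarith
    · rw [← ENNReal.ofReal_add (Real.rpow_nonneg hd0 t) hη.le,
        ← ENNReal.ofReal_mul (by positivity)]
      apply ENNReal.ofReal_le_ofReal
      have h1 : (1 / 2 : ℝ) ^ k ≤ 4 * d' := by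
        rw [pow_succ] at hk1; linarith
      calc ((1 / 2 : ℝ) ^ k) ^ t ≤ (4 * d') ^ t := by gcongr
        _ = 4 ^ t * d' ^ t := Real.mul_rpow (by norm_num) hd'0.le
        _ ≤ _ := by gcongr
  set ε1 : ℝ≥0∞ := ε / ENNReal.ofReal (4 ^ t) / 2 with hε1
  have hε10 : ε1 ≠ 0 := by
    rw [hε1]
    exact (ENNReal.div_pos (ENNReal.div_pos hε ENNReal.ofReal_ne_top).ne' (by simp)).ne'
  obtain ⟨η, hη0, hηs⟩ := ENNReal.exists_pos_sum_of_countable hε10 ℕ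
  rw [Measure.hausdorffMeasure_apply] at hS0
  have hinf : (⨅ (E : ℕ → Set (EuclideanSpace ℝ (Fin n))) (_ : S ⊆ ⋃ j, E j)
      (_ : ∀ j, ediam (E j) ≤ ENNReal.ofReal (1 / 4)),
      ∑' j, ⨆ _ : (E j).Nonempty, ediam (E j) ^ t) < ε1 := by
    refine lt_of_le_of_lt ?_ (pos_iff_ne_zero.2 hε10)
    rw [← hS0]
    exact le_iSup₂_of_le (ENNReal.ofReal (1 / 4)) (by simp) le_rfl
  simp only [iInf_lt_iff] at hinf
  obtain ⟨E, hE1, hE2, hE3⟩ := hinf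
  have hchoose : ∀ j, ∃ p : (Σ k, T k),
      E j ∩ S ⊆ ball (p.2 : EuclideanSpace ℝ (Fin n)) (2 * (1 / 2 : ℝ) ^ p.1) ∧
      ENNReal.ofReal (((1 / 2 : ℝ) ^ p.1) ^ t) ≤
        ENNReal.ofReal (4 ^ t) * ((⨆ _ : (E j).Nonempty, ediam (E j) ^ t) + η j) := by
    intro j
    have hηj : (0 : ℝ) < η j := hη0 j
    rcases (E j ∩ S).eq_empty_or_nonempty with he | ⟨x, hxE, hxS⟩
    · obtain ⟨p, _, hp⟩ := hpick x0 hx0 0 (η j) le_rfl (by norm_num) hηj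
      refine ⟨p, by simp [he], hp.trans ?_⟩
      rw [Real.zero_rpow ht.ne', ENNReal.ofReal_zero, ENNReal.ofReal_coe_nnreal]
      gcongr
      exact zero_le
    · have hfin : ediam (E j) ≠ ∞ := ne_top_of_le_ne_top ENNReal.ofReal_ne_top (hE2 j)
      obtain ⟨p, hp1, hp⟩ := hpick x hxS (ediam (E j)).toReal (η j) ENNReal.toReal_nonneg
        (ENNReal.toReal_le_of_le_ofReal (by norm_num) (hE2 j)) hηj
      refine ⟨p, fun y hy => hp1 ?_, hp.trans ?_⟩
      · rw [mem_closedBall, dist_edist]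
        exact ENNReal.toReal_mono hfin (edist_le_ediam_of_mem hy.1 hxE)
      · rw [ENNReal.ofReal_coe_nnreal, ← ENNReal.ofReal_rpow_of_nonneg ENNReal.toReal_nonneg ht.le,
          ENNReal.ofReal_toReal hfin]
        gcongr
        exact le_iSup_of_le ⟨x, hxE⟩ le_rfl
  choose p hp1 hp2 using hchoose
  obtain ⟨I, hI⟩ := hS.elim_finite_subcover
    (fun j => ball ((p j).2 : EuclideanSpace ℝ (Fin n)) (2 * (1 / 2 : ℝ) ^ (p j).1))
    (fun j => isOpen_ball) (fun x hx => by
      obtain ⟨j, hj⟩ := Set.mem_iUnion.1 (hE1 hx)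
      exact Set.mem_iUnion.2 ⟨j, hp1 j ⟨hj, hx⟩⟩)
  refine ⟨I.image p, fun x hx => ?_, ?_⟩
  · have := hI hx
    simp only [Set.mem_iUnion] at this
    obtain ⟨j, hj, hxj⟩ := this
    exact ⟨p j, Finset.mem_image_of_mem _ hj, hxj⟩
  · have h1 : ∑ q ∈ I.image p, ENNReal.ofReal (((1 / 2 : ℝ) ^ q.1) ^ t) ≤
        ∑ j ∈ I, ENNReal.ofReal (((1 / 2 : ℝ) ^ (p j).1) ^ t) :=
      Finset.sum_image_le_of_nonneg (fun _ _ => zero_le)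
    refine h1.trans ((Finset.sum_le_sum fun j _ => hp2 j).trans ?_)
    refine (ENNReal.sum_le_tsum I).trans ?_
    rw [ENNReal.tsum_mul_left, ENNReal.tsum_add]
    calc _ ≤ ENNReal.ofReal (4 ^ t) * (ε1 + ε1) := by
          gcongr
      _ = ε := by
          rw [hε1, ENNReal.add_halves]
          exact ENNReal.mul_div_cancel (by simp; positivity) ENNReal.ofReal_ne_top

theorem upper_part {n m : ℕ} {s : ℝ} (hs : (m : ℝ) < s)
    {Λ : Type*} [MetricSpace Λ] [CompactSpace Λ] [MeasurableSpace Λ] [BorelSpace Λ]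
    {P : Λ → (EuclideanSpace ℝ (Fin n) →ₗ[ℝ] EuclideanSpace ℝ (Fin m))}
    (hP : ∀ l, IsOrthoProj (P l)) (hPcont : ∀ x, Continuous fun l => P l x)
    {A : Set (EuclideanSpace ℝ (Fin n))} (hA : μH[s] A < ∞) :
    ∃ Z : Set (EuclideanSpace ℝ (Fin m) × Λ), MeasurableSet Z ∧
      (∀ l, volume {u | (u, l) ∈ Z} = 0) ∧
      ∀ u l, (u, l) ∉ Z → dimH ((fun y => P l y) ⁻¹' {u} ∩ A) ≤ ENNReal.ofReal (s - m) := by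
  have hs0 : 0 < s := lt_of_le_of_lt (by positivity) hs
  have hsm : 0 < s - m := by linarith
  have hcov : ∀ k : ℕ, ∃ E : ℕ → Set (EuclideanSpace ℝ (Fin n)), A ⊆ ⋃ j, E j ∧
      (∀ j, ediam (E j) ≤ ((k : ℝ≥0∞) + 1)⁻¹) ∧ ∑' j, ediam (E j) ^ s ≤ μH[s] A + 1 := by
    intro k
    have h1 : (⨅ (E : ℕ → Set (EuclideanSpace ℝ (Fin n))) (_ : A ⊆ ⋃ j, E j)
        (_ : ∀ j, ediam (E j) ≤ ((k : ℝ≥0∞) + 1)⁻¹),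
        ∑' j, ⨆ _ : (E j).Nonempty, ediam (E j) ^ s) < μH[s] A + 1 := by
      refine lt_of_le_of_lt ?_ (ENNReal.lt_add_right hA.ne one_ne_zero)
      conv_rhs => rw [Measure.hausdorffMeasure_apply]
      exact le_iSup₂_of_le ((k : ℝ≥0∞) + 1)⁻¹ (by simp) le_rfl
    simp only [iInf_lt_iff] at h1
    obtain ⟨E, hE1, hE2, hE3⟩ := h1
    refine ⟨E, hE1, hE2, le_trans (ENNReal.tsum_le_tsum fun j => ?_) hE3.le⟩
    rcases (E j).eq_empty_or_nonempty with he | hne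
    · simp [he, hs0]
    · exact le_iSup_of_le hne le_rfl
  choose E hE1 hE2 hE3 using hcov
  have hfin : ∀ k j, ediam (E k j) ≠ ∞ := fun k j =>
    ne_top_of_le_ne_top (by simp) (hE2 k j)
  have hx : ∀ k j, ∃ x, (E k j).Nonempty → x ∈ E k j := by
    intro k j
    by_cases h : (E k j).Nonempty
    · exact ⟨h.some, fun _ => h.some_mem⟩
    · exact ⟨0, fun h' => absurd h' h⟩
  choose x hx using hx
  set Y : ℕ → ℕ → Set (EuclideanSpace ℝ (Fin m) × Λ) := fun k j =>
    {q | dist q.1 (P q.2 (x k j)) ≤ (ediam (E k j)).toReal} with hY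
  have hYm : ∀ k j, MeasurableSet (Y k j) := fun k j => by
    have : IsClosed (Y k j) := by
      refine isClosed_le (Continuous.dist continuous_fst ?_) continuous_const
      exact (hPcont (x k j)).comp continuous_snd
    exact this.measurableSet
  set f : ℕ → EuclideanSpace ℝ (Fin m) × Λ → ℝ≥0∞ := fun k q =>
    ∑' j, (Y k j).indicator (fun _ => ediam (E k j) ^ (s - m)) q with hf
  have hfm : ∀ k, Measurable (f k) := fun k =>
    Measurable.tsum fun j => measurable_const.indicator (hYm k j)
  have hFm : Measurable fun q => liminf (fun k => f k q) atTop := Measurable.liminf hfm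
  set α := volume (closedBall (0 : EuclideanSpace ℝ (Fin m)) 1) with hα
  have hαfin : α ≠ ∞ := measure_closedBall_lt_top.ne
  have hfi : ∀ k l, ∫⁻ u, f k (u, l) ≤ (μH[s] A + 1) * α := by
    intro k l
    simp only [hf]
    rw [lintegral_tsum]
    · refine le_trans (le_of_eq ?_) (mul_le_mul_left (hE3 k) _)
      rw [← ENNReal.tsum_mul_right]
      refine tsum_congr fun j => ?_
      have h1 : (fun u : EuclideanSpace ℝ (Fin m) =>
          (Y k j).indicator (fun _ => ediam (E k j) ^ (s - m)) (u, l)) =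
          (closedBall (P l (x k j)) (ediam (E k j)).toReal).indicator
            (fun _ => ediam (E k j) ^ (s - m)) := by
        funext u
        simp only [Set.indicator]
        rfl
      rw [h1, lintegral_indicator measurableSet_closedBall, setLIntegral_const,
        Measure.addHaar_closedBall' volume _ ENNReal.toReal_nonneg, ← mul_assoc]
      congr 1
      rw [ENNReal.ofReal_pow ENNReal.toReal_nonneg, ENNReal.ofReal_toReal (hfin k j),
        finrank_euclideanSpace_fin, ← ENNReal.rpow_natCast,
        ← ENNReal.rpow_add_of_nonneg _ _ hsm.le (by positivity)]
      congr 1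
      ring
    · intro j
      exact ((measurable_const.indicator (hYm k j)).comp measurable_prodMk_right).aemeasurable
  refine ⟨{q | liminf (fun k => f k q) atTop = ∞}, hFm (measurableSet_singleton ∞), ?_, ?_⟩
  · intro l
    have h1 : ∫⁻ u, liminf (fun k => f k (u, l)) atTop ≠ ∞ := by
      refine ne_top_of_le_ne_top (ENNReal.mul_ne_top (b := α) (a := μH[s] A + 1)
        (by simp [hA.ne]) hαfin) ?_
      refine (lintegral_liminf_le fun k => (hfm k).comp measurable_prodMk_right).trans ?_
      refine le_trans (liminf_le_liminf (v := fun _ => (μH[s] A + 1) * α)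
        (Eventually.of_forall fun k => hfi k l)) ?_
      simp
    have h2 := ae_lt_top (hFm.comp measurable_prodMk_right) h1
    refine measure_eq_zero_iff_ae_notMem.2 ?_
    filter_upwards [h2] with u hu
    exact hu.ne
  · intro u l hul
    have h1 : μH[s - m] ((fun y => P l y) ⁻¹' {u} ∩ A) ≤ liminf (fun k => f k (u, l)) atTop := by
      refine (Measure.hausdorffMeasure_le_liminf_tsum (s - m) _ (l := atTop)
        (fun k : ℕ => ((k : ℝ≥0∞) + 1)⁻¹) ?_
        (fun k j => E k j ∩ (fun y => P l y) ⁻¹' {u}) ?_ ?_).trans ?_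
      · have := (tendsto_add_atTop_iff_nat 1).2 ENNReal.tendsto_inv_nat_nhds_zero
        simpa using this
      · exact Eventually.of_forall fun k j => (ediam_mono Set.inter_subset_left).trans (hE2 k j)
      · refine Eventually.of_forall fun k y hy => ?_
        obtain ⟨j, hj⟩ := Set.mem_iUnion.1 (hE1 k hy.2)
        exact Set.mem_iUnion.2 ⟨j, hj, hy.1⟩
      · refine liminf_le_liminf (Eventually.of_forall fun k => ENNReal.tsum_le_tsum fun j => ?_)
        rcases (E k j ∩ (fun y => P l y) ⁻¹' {u}).eq_empty_or_nonempty with he | ⟨y, hyE, hyu⟩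
        · simp [he, hsm]
        · have hmem : (u, l) ∈ Y k j := by
            have hyu' : P l y = u := hyu
            simp only [hY]
            change dist u (P l (x k j)) ≤ _
            rw [← hyu', dist_eq_norm, ← map_sub]
            refine ((hP l).norm_le _).trans ?_
            rw [← dist_eq_norm, dist_edist]
            exact ENNReal.toReal_mono (hfin k j) (edist_le_ediam_of_mem hyE (hx k j ⟨y, hyE⟩))
          rw [Set.indicator_of_mem hmem]
          exact ENNReal.rpow_le_rpow (ediam_mono Set.inter_subset_left) hsm.le
    have h2 : μH[((s - m).toNNReal : ℝ)] ((fun y => P l y) ⁻¹' {u} ∩ A) ≠ ∞ := by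
      rw [Real.coe_toNNReal _ hsm.le]
      exact ne_top_of_le_ne_top hul h1
    exact dimH_le_of_hausdorffMeasure_ne_top h2

theorem lower_piece {n m : ℕ} {s : ℝ} (hs : (m : ℝ) < s)
    {Λ : Type*} [MetricSpace Λ] [CompactSpace Λ] [MeasurableSpace Λ] [BorelSpace Λ]
    {ω : Measure Λ} [IsFiniteMeasure ω]
    {P : Λ → (EuclideanSpace ℝ (Fin n) →ₗ[ℝ] EuclideanSpace ℝ (Fin m))}
    (hP : ∀ l, IsOrthoProj (P l)) (hPcont : ∀ x, Continuous fun l => P l x)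
    {C : ℝ} (hC : 0 < C) (hmain : MainHyp s ω P C)
    {ν : Measure (EuclideanSpace ℝ (Fin n))} [IsFiniteMeasure ν]
    {K : Set (EuclideanSpace ℝ (Fin n))} (hKc : IsCompact K) {M c : ℝ} (hM : 0 < M) (hc : 0 < c)
    (hfr : ∀ x r, 0 < r → (ν.restrict K) (closedBall x r) ≤ ENNReal.ofReal (M * r ^ s))
    (hlo : ∀ x ∈ K, ∀ r : ℝ, 0 < r → r ≤ 1 → ENNReal.ofReal (c * r ^ s) ≤ ν (closedBall x r))
    {t : ℝ} (ht : 0 < t) (hts : t < s - m) :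
    ∀ᵐ q ∂((ν.restrict K).prod ω), μH[t] ((fun y => P q.2 y) ⁻¹' {P q.2 q.1} ∩ K) ≠ 0 := by
  have hs0 : 0 < s := lt_of_le_of_lt (by positivity) hs
  have hcover : ∀ k : ℕ, ∃ T : Finset (EuclideanSpace ℝ (Fin n)),
      K ⊆ (⋃ a ∈ T, closedBall a ((1 / 2 : ℝ) ^ k)) ∧
      (T.card : ℝ) ≤ ν.real Set.univ * 4 ^ s / c * (((1 / 2 : ℝ) ^ k) ^ s)⁻¹ := fun k =>
    cover_count hc hlo (by positivity) (pow_le_one₀ (by norm_num) (by norm_num))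
  choose T hT hcard using hcover
  set μ := ν.restrict K with hμ
  have hμK : μ Kᶜ = 0 := by
    rw [hμ, Measure.restrict_apply hKc.measurableSet.compl]; simp
  have hG : ∀ p : (Σ k, T k), ∃ G : Λ → ℝ≥0∞, Measurable G ∧
      ∫⁻ l, G l ∂ω ≤ ENNReal.ofReal (M ^ 2 * C * (2 * (1 / 2 : ℝ) ^ p.1) ^ (2 * s - m)) ∧
      ∀ᵐ l ∂ω, HasL2 ((μ.restrict (closedBall (p.2 : EuclideanSpace ℝ (Fin n))
        (2 * (1 / 2 : ℝ) ^ p.1))).map (P l)) (G l) := fun p =>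
    step2 hs0 hP hPcont hC hmain μ hM hfr _ (by positivity)
  choose G hGm hGi hGL using hG
  set w : (Σ k, T k) → ℝ≥0∞ := fun p => ENNReal.ofReal (((1 / 2 : ℝ) ^ p.1) ^ t) with hw
  have hwpos : ∀ k : ℕ, (0 : ℝ) < ((1 / 2 : ℝ) ^ k) ^ t := fun k => by positivity
  have hw0 : ∀ p, w p ≠ 0 := fun p => by
    simp only [hw, ne_eq, ENNReal.ofReal_eq_zero, not_le]; exact hwpos _
  have hwt : ∀ p, w p ≠ ∞ := fun p => ENNReal.ofReal_ne_top
  -- total sum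
  have hsum : ∑' p, (w p)⁻¹ * ∫⁻ l, G p l ∂ω ≠ ∞ := by
    set Q : ℝ := ν.real Set.univ * 4 ^ s / c with hQ
    have hQ0 : 0 ≤ Q := by
      have : 0 ≤ ν.real Set.univ := measureReal_nonneg
      positivity
    set D : ℝ := Q * (M ^ 2 * C * 2 ^ (2 * s - m)) with hD
    have hD0 : 0 ≤ D := by positivity
    set θ : ℝ := (1 / 2 : ℝ) ^ (s - m - t) with hθ
    have hθ0 : 0 < θ := by positivity
    have hθ1 : θ < 1 := Real.rpow_lt_one (by norm_num) (by norm_num) (by linarith)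
    have hle : ∑' p, (w p)⁻¹ * ∫⁻ l, G p l ∂ω ≤ ∑' k : ℕ, ENNReal.ofReal (D * θ ^ k) := by
      rw [ENNReal.tsum_sigma']
      refine ENNReal.tsum_le_tsum fun k => ?_
      set ρ : ℝ := (1 / 2 : ℝ) ^ k with hρ
      have hρ0 : 0 < ρ := by positivity
      have h1 : ∀ a : T k, (w ⟨k, a⟩)⁻¹ * ∫⁻ l, G ⟨k, a⟩ l ∂ω ≤
          ENNReal.ofReal ((ρ ^ t)⁻¹ * (M ^ 2 * C * (2 * ρ) ^ (2 * s - m))) := by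
        intro a
        rw [ENNReal.ofReal_mul (by positivity), ENNReal.ofReal_inv_of_pos (by positivity)]
        exact mul_le_mul_right (hGi ⟨k, a⟩) _
      refine (ENNReal.tsum_le_tsum h1).trans ?_
      rw [tsum_fintype, Finset.sum_const, ← ENNReal.ofReal_nsmul, nsmul_eq_mul]
      apply ENNReal.ofReal_le_ofReal
      rw [Finset.card_univ, Fintype.card_coe]
      calc ((T k).card : ℝ) * ((ρ ^ t)⁻¹ * (M ^ 2 * C * (2 * ρ) ^ (2 * s - m)))
          ≤ (Q * (ρ ^ s)⁻¹) * ((ρ ^ t)⁻¹ * (M ^ 2 * C * (2 * ρ) ^ (2 * s - m))) := by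
            gcongr
            exact hcard k
        _ = D * ((ρ ^ s)⁻¹ * (ρ ^ t)⁻¹ * ρ ^ (2 * s - m)) := by
            rw [Real.mul_rpow (by norm_num) hρ0.le, hD]; ring
        _ = D * θ ^ k := by
            congr 1
            rw [← Real.rpow_neg hρ0.le, ← Real.rpow_neg hρ0.le, ← Real.rpow_add hρ0,
              ← Real.rpow_add hρ0, hθ, hρ, ← Real.rpow_natCast, ← Real.rpow_natCast,
              ← Real.rpow_mul (by norm_num), ← Real.rpow_mul (by norm_num)]
            congr 1
            ring
    refine ne_top_of_le_ne_top ?_ hle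
    rw [← ENNReal.ofReal_tsum_of_nonneg (fun k => by positivity)
      ((summable_geometric_of_lt_one hθ0.le hθ1).mul_left D)]
    exact ENNReal.ofReal_ne_top
  have hsumae : ∀ᵐ l ∂ω, ∑' p, (w p)⁻¹ * G p l < ∞ := by
    refine ae_lt_top (Measurable.tsum fun p => (hGm p).const_mul _) ?_
    rw [lintegral_tsum fun p => ((hGm p).const_mul _).aemeasurable]
    refine ne_top_of_le_ne_top hsum (ENNReal.tsum_le_tsum fun p => ?_)
    rw [lintegral_const_mul _ (hGm p)]
  -- absolute continuity
  obtain ⟨R, hR⟩ := hKc.isBounded.subset_closedBall (0 : EuclideanSpace ℝ (Fin n))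
  obtain ⟨G', _, _, hG'⟩ := step2 hs0 hP hPcont hC hmain μ hM hfr 0
    (show (0 : ℝ) < max R 1 by positivity)
  have hres : μ.restrict (closedBall 0 (max R 1)) = μ := by
    refine Measure.restrict_eq_self_of_ae_mem ?_
    filter_upwards [measure_eq_zero_iff_ae_notMem.1 hμK] with x hx
    have hx' : x ∈ K := by simpa using hx
    exact closedBall_subset_closedBall (le_max_left _ _) (hR hx')
  rw [hres] at hG'
  set V : (Σ k, T k) → Set (EuclideanSpace ℝ (Fin n)) := fun p =>
    ball (p.2 : EuclideanSpace ℝ (Fin n)) (2 * (1 / 2 : ℝ) ^ p.1) with hV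
  set Z := {q : EuclideanSpace ℝ (Fin n) × Λ | ∀ N : ℕ, ∃ J : Finset (Σ k, T k),
      (∀ x ∈ K, P q.2 x = P q.2 q.1 → ∃ p ∈ J, x ∈ V p) ∧
      ∑ p ∈ J, w p ≤ ((N : ℝ≥0∞) + 1)⁻¹} with hZ
  have hZm : MeasurableSet Z := bad_joint hP hPcont hKc (fun p => isOpen_ball) w
  have hZ0 : (μ.prod ω) Z = 0 := by
    rw [Measure.prod_apply_symm hZm]
    have : ∀ᵐ l ∂ω, μ ((fun x => (x, l)) ⁻¹' Z) = 0 := by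
      filter_upwards [hsumae, ae_all_iff.2 hGL, hG'] with l h1 h2 h3
      have h4 := bad_null hKc hμK (proj_cont (P l)) (V := V) (w := w) (fun p => isOpen_ball)
        (fun p => ball_subset_closedBall) hw0 hwt h2 h1.ne h3.ac
      exact le_antisymm ((Measure.le_map_apply (proj_cont (P l)).measurable.aemeasurable _).trans
        h4.le) zero_le
    rw [lintegral_congr_ae this]
    simp
  filter_upwards [measure_eq_zero_iff_ae_notMem.1 hZ0] with q hq h0
  apply hq
  intro N
  have hScl : IsClosed ((fun y => P q.2 y) ⁻¹' {P q.2 q.1}) :=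
    isClosed_singleton.preimage (proj_cont (P q.2))
  obtain ⟨J, hJ1, hJ2⟩ := cover_small ht (hKc.inter_left hScl) Set.inter_subset_right h0 T hT
    (ε := ((N : ℝ≥0∞) + 1)⁻¹) (by simp)
  exact ⟨J, fun x hx hxq => hJ1 x ⟨hxq, hx⟩, hJ2⟩

theorem ac_part {n m : ℕ} {s : ℝ} (hs0 : 0 < s)
    {Λ : Type*} [MetricSpace Λ] [CompactSpace Λ] [MeasurableSpace Λ] [BorelSpace Λ]
    {ω : Measure Λ} [IsFiniteMeasure ω]
    {P : Λ → (EuclideanSpace ℝ (Fin n) →ₗ[ℝ] EuclideanSpace ℝ (Fin m))}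
    (hP : ∀ l, IsOrthoProj (P l)) (hPcont : ∀ x, Continuous fun l => P l x)
    {C : ℝ} (hC : 0 < C) (hmain : MainHyp s ω P C)
    {ν : Measure (EuclideanSpace ℝ (Fin n))} [IsFiniteMeasure ν]
    (hν : ∀ᵐ x ∂ν, ∃ M, x ∈ FrSet s ν M) :
    ∀ᵐ l ∂ω, ν.map (P l) ≪ volume := by
  have h1 : ∀ M R : ℕ, ∀ᵐ l ∂ω,
      (((ν.restrict (FrSet s ν M)).restrict (closedBall 0 ((R : ℝ) + 1))).map (P l)) ≪
        volume := by
    intro M R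
    obtain ⟨G, _, _, hG⟩ := step2 hs0 hP hPcont hC hmain (ν.restrict (FrSet s ν M))
      (M := ((M : ℝ) + 1) * 4 ^ s) (by positivity)
      (FrSet.bound hs0 (FrSet.measurableSet s ν M) subset_rfl) 0
      (show (0 : ℝ) < (R : ℝ) + 1 by positivity)
    filter_upwards [hG] with l hl using hl.ac
  filter_upwards [ae_all_iff.2 fun M => ae_all_iff.2 (h1 M)] with l hl
  refine Measure.AbsolutelyContinuous.mk fun S hS hS0 => ?_
  have hPm := (proj_cont (P l)).measurable
  rw [Measure.map_apply hPm hS]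
  have h2 : ∀ M R : ℕ, ν (P l ⁻¹' S ∩ closedBall 0 ((R : ℝ) + 1) ∩ FrSet s ν M) = 0 := by
    intro M R
    have h3 := hl M R hS0
    rwa [Measure.map_apply hPm hS, Measure.restrict_apply (hPm hS),
      Measure.restrict_apply ((hPm hS).inter measurableSet_closedBall)] at h3
  have h4 : ν (⋃ M : ℕ, ⋃ R : ℕ, P l ⁻¹' S ∩ closedBall 0 ((R : ℝ) + 1) ∩ FrSet s ν M) = 0 :=
    measure_iUnion_null fun M => measure_iUnion_null fun R => h2 M R
  refine le_antisymm (le_trans (measure_mono_ae ?_) h4.le) zero_le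
  filter_upwards [hν] with x hx hxS
  obtain ⟨M, hM⟩ := hx
  obtain ⟨R, hR⟩ := exists_nat_gt ‖x‖
  refine Set.mem_iUnion.2 ⟨M, Set.mem_iUnion.2 ⟨R, ⟨hxS, ?_⟩, hM⟩⟩
  rw [mem_closedBall, dist_zero_right]
  linarith

theorem compact_exhaust {n : ℕ} (ν : Measure (EuclideanSpace ℝ (Fin n))) [IsFiniteMeasure ν]
    {X : Set (EuclideanSpace ℝ (Fin n))} (hX : MeasurableSet X) :
    ∃ K : ℕ → Set (EuclideanSpace ℝ (Fin n)), (∀ i, IsCompact (K i)) ∧ (∀ i, K i ⊆ X) ∧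
      ν (X \ ⋃ i, K i) = 0 := by
  have h : ∀ i : ℕ, ∃ K ⊆ X, IsCompact K ∧ ν (X \ K) < ((i : ℝ≥0∞) + 1)⁻¹ := fun i =>
    hX.exists_isCompact_sdiff_lt (measure_ne_top ν X) (by simp)
  choose K h1 h2 h3 using h
  refine ⟨K, h2, h1, le_antisymm ?_ zero_le⟩
  have ht : Tendsto (fun i : ℕ => ((i : ℝ≥0∞) + 1)⁻¹) atTop (𝓝 0) := by
    have := (tendsto_add_atTop_iff_nat 1).2 ENNReal.tendsto_inv_nat_nhds_zero
    simpa using this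
  refine ge_of_tendsto' ht fun i => le_trans (measure_mono ?_) (h3 i).le
  exact Set.diff_subset_diff_right (Set.subset_iUnion _ _)

theorem stmt0 {n m : ℕ} (hm : 1 ≤ m) (hmn : m < n) {s : ℝ} (hs : (m : ℝ) < s)
    {Λ : Type*} [MetricSpace Λ] [CompactSpace Λ] [MeasurableSpace Λ] [BorelSpace Λ]
    (ω : Measure Λ) [IsFiniteMeasure ω] (hω : ω ≠ 0)
    (P : Λ → (EuclideanSpace ℝ (Fin n) →ₗ[ℝ] EuclideanSpace ℝ (Fin m)))
    (hP : ∀ l, IsOrthoProj (P l))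
    (hPcont : ∀ x, Continuous fun l => P l x)
    (C : ℝ) (hC : 0 < C)
    (hmain : ∀ μ : Measure (EuclideanSpace ℝ (Fin n)), IsFiniteMeasure μ → μ ≠ 0 →
      (∃ K, IsCompact K ∧ K ⊆ closedBall 0 1 ∧ μ Kᶜ = 0) →
      (∀ x r, 0 < r → μ (closedBall x r) ≤ ENNReal.ofReal (r ^ s)) →
      (∀ᵐ l ∂ω, μ.map (P l) ≪ volume) ∧
        ∫⁻ l, ∫⁻ u, densD (μ.map (P l)) u ^ 2 ∂volume ∂ω < ENNReal.ofReal C)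
    (A : Set (EuclideanSpace ℝ (Fin n))) (hAm : NullMeasurableSet A μH[s])
    (hA0 : 0 < μH[s] A) [hA1 : Fact (μH[s] A < ∞)]
    (hld : ∀ᵐ x ∂(μH[s].restrict A), 0 < lowerDensity s A x) :
    ∀ᵐ q ∂((μH[s].restrict A).prod ω),
      dimH ((fun y => P q.2 y) ⁻¹' {P q.2 q.1} ∩ A) = ENNReal.ofReal (s - m) := by
  have hs0 : 0 < s := lt_of_le_of_lt (by positivity) hs
  have hA : μH[s] A < ∞ := hA1.out
  have hmain' : MainHyp s ω P C := hmain
  set ν := (μH[s] : Measure (EuclideanSpace ℝ (Fin n))).restrict A with hν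
  have hfin : IsFiniteMeasure ν := inferInstance
  have hFr : ∀ᵐ x ∂ν, ∃ M, x ∈ FrSet s ν M := FrSet.null hs0 A
  have hLo : ∀ᵐ x ∂ν, ∃ M, x ∈ LoSet s ν M := LoSet.null hs0 A hld
  -- upper bound
  have hup : ∀ᵐ q ∂(ν.prod ω),
      dimH ((fun y => P q.2 y) ⁻¹' {P q.2 q.1} ∩ A) ≤ ENNReal.ofReal (s - m) := by
    obtain ⟨Z, hZm, hZ0, hZ⟩ := upper_part hs hP hPcont hA
    have hmeas : Measurable fun q : EuclideanSpace ℝ (Fin n) × Λ => (P q.2 q.1, q.2) :=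
      (joint_cont hP hPcont).measurable.prodMk measurable_snd
    have h0 : (ν.prod ω) ((fun q : EuclideanSpace ℝ (Fin n) × Λ => (P q.2 q.1, q.2)) ⁻¹' Z)
        = 0 := by
      rw [Measure.prod_apply_symm (hmeas hZm)]
      have : ∀ᵐ l ∂ω, ν ((fun x => (x, l)) ⁻¹'
          ((fun q : EuclideanSpace ℝ (Fin n) × Λ => (P q.2 q.1, q.2)) ⁻¹' Z)) = 0 := by
        filter_upwards [ac_part hs0 hP hPcont hC hmain' hFr] with l hl
        have h1 := hl (hZ0 l)
        exact le_antisymm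
          ((Measure.le_map_apply (proj_cont (P l)).measurable.aemeasurable _).trans h1.le) zero_le
      rw [lintegral_congr_ae this]
      simp
    filter_upwards [measure_eq_zero_iff_ae_notMem.1 h0] with q hq
    exact hZ _ _ hq
  -- pieces
  obtain ⟨A0, hA0A, hA0m, hA0e⟩ := hAm.exists_measurable_subset_ae_eq
  have hA0ν : ∀ᵐ x ∂ν, x ∈ A0 := by
    rw [hν, ← Measure.restrict_congr_set hA0e]
    exact ae_restrict_mem hA0m
  have hKex := fun M M' : ℕ => compact_exhaust ν
    ((hA0m.inter (FrSet.measurableSet s ν M)).inter (LoSet.measurableSet s ν M'))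
  choose K hKc hKX hK0 using hKex
  have hKae : ∀ᵐ x ∂ν, ∃ M M' i, x ∈ K M M' i := by
    have h1 := ae_all_iff.2 fun M => ae_all_iff.2 fun M' =>
      measure_eq_zero_iff_ae_notMem.1 (hK0 M M')
    filter_upwards [h1, hA0ν, hFr, hLo] with x hx hxA ⟨M, hM⟩ ⟨M', hM'⟩
    by_contra hcon
    refine hx M M' ⟨⟨⟨hxA, hM⟩, hM'⟩, fun h => ?_⟩
    obtain ⟨i, hi⟩ := Set.mem_iUnion.1 h
    exact hcon ⟨M, M', i, hi⟩
  have hKae' : ∀ᵐ q ∂(ν.prod ω), ∃ M M' i, q.1 ∈ K M M' i :=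
    Measure.quasiMeasurePreserving_fst.ae hKae
  have hlow : ∀ M M' i : ℕ, ∀ t : ℚ, ∀ᵐ q ∂(ν.prod ω), q.1 ∈ K M M' i →
      ((0 : ℝ) < t ∧ (t : ℝ) < s - m) →
      μH[(t : ℝ)] ((fun y => P q.2 y) ⁻¹' {P q.2 q.1} ∩ K M M' i) ≠ 0 := by
    intro M M' i t
    by_cases ht : (0 : ℝ) < t ∧ (t : ℝ) < s - m
    · obtain ⟨c, hc, hlo⟩ := LoSet.bound hs0 (ν := ν) M'
      have hKm := (hKc M M' i).measurableSet
      have h1 := lower_piece hs hP hPcont hC hmain' (hKc M M' i)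
        (M := ((M : ℝ) + 1) * 4 ^ s) (by positivity) hc
        (FrSet.bound hs0 hKm fun x hx => (hKX M M' i hx).1.2)
        (fun x hx => hlo x (hKX M M' i hx).2) ht.1 ht.2
      have h2 : (ν.restrict (K M M' i)).prod ω =
          (ν.prod ω).restrict (K M M' i ×ˢ Set.univ) := by
        rw [← Measure.prod_restrict, Measure.restrict_univ]
      rw [h2, ae_restrict_iff' (hKm.prod MeasurableSet.univ)] at h1
      filter_upwards [h1] with q hq hqK _
      exact hq ⟨hqK, Set.mem_univ _⟩
    · exact Eventually.of_forall fun q _ h => absurd h ht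
  have hlow' := ae_all_iff.2 fun M => ae_all_iff.2 fun M' => ae_all_iff.2 fun i =>
    ae_all_iff.2 (hlow M M' i)
  filter_upwards [hup, hKae', hlow'] with q hq1 ⟨M, M', i, hqK⟩ hq2
  refine le_antisymm hq1 (le_of_not_gt fun hlt => ?_)
  obtain ⟨t, ht0, ht1, ht2⟩ := ENNReal.lt_iff_exists_rat_btwn.1 hlt
  have htt : 0 < s - m := by linarith
  have ht2' : (t : ℝ) < s - m := by
    have := (ENNReal.ofReal_lt_ofReal_iff htt).1 ht2
    exact this
  have ht3 : (0 : ℝ) < t := by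
    by_contra hcon
    rw [Real.toNNReal_of_nonpos (not_lt.1 hcon)] at ht1
    simp at ht1
  refine hq2 M M' i t hqK ⟨ht3, ht2'⟩ ?_
  have h5 := hausdorffMeasure_of_dimH_lt ht1
  rw [Real.coe_toNNReal _ ht3.le] at h5
  exact measure_mono_null (Set.inter_subset_inter_right _
    fun x hx => hA0A (hKX M M' i hx).1.1) h5

end
end

section
/- Let n > m ≥ 1 be integers and let s > m. Let Λ be a compact metric space, ω a finite nonzero Borel measure on Λ, and (P_λ)_{λ∈Λ} a family of orthogonal projections from ℝⁿ onto ℝᵐ such that λ ↦ P_λ x is continuous for every x ∈ ℝⁿ. Suppose there is a constant C > 0 such that for every μ' ∈ M(Bⁿ(0,1)) satisfying μ'(B(x,r)) ≤ r^s for all x ∈ ℝⁿ, r > 0, the push-forward P_{λ♯}μ' is absolutely continuous with respect to L^m for ω-almost all λ and ∫_Λ ∫_{ℝᵐ} D(P_{λ♯}μ', u)² dL^m(u) dω(λ) < C. Let A ⊂ ℝⁿ be compact and H^s-measurable with 0 < H^s(A) < ∞, let μ = 10^{-s} H^s restricted to A, and assume μ(B(x,r)) ≤ (r/2)^s for all x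 ∈ ℝⁿ, r > 0, and that there exist b, r₀ > 0 with μ(B(a,r)) ≥ b r^s for all a in the support of μ and 0 < r < r₀. Then for every t with 0 < t < s − m, for ω-almost all λ ∈ Λ and μ-almost all x ∈ A, lim_{r→0} liminf_{δ→0} r^{-t} δ^{-m} μ({y ∈ B(x,r) : |P_λ(y − x)| ≤ δ}) = 0. -/
open MeasureTheory Metric Filter
open scoped ENNReal Topology

noncomputable section

section aux

set_option linter.unusedSectionVars false

variable {n m : ℕ} {Λ : Type*} [MetricSpace Λ] [CompactSpace Λ] [MeasurableSpace Λ] [BorelSpace Λ]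

lemma aux_cont (P : Λ → (EuclideanSpace ℝ (Fin n) →ₗ[ℝ] EuclideanSpace ℝ (Fin m)))
    (hPcont : ∀ x, Continuous fun l => P l x) :
    Continuous (fun p : Λ × EuclideanSpace ℝ (Fin n) => P p.1 p.2) := by
  have : (fun p : Λ × EuclideanSpace ℝ (Fin n) => P p.1 p.2) =
      fun p => ∑ i, p.2 i • P p.1 (EuclideanSpace.basisFun (Fin n) ℝ i) := by
    funext p
    conv_lhs => rw [← (EuclideanSpace.basisFun (Fin n) ℝ).sum_repr p.2]
    rw [map_sum]
    simp
  rw [this]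
  refine continuous_finsetSum _ fun i _ => ?_
  have h1 : Continuous fun p : Λ × EuclideanSpace ℝ (Fin n) => p.2 i := by fun_prop
  exact h1.smul ((hPcont _).comp continuous_fst)

/-- Lower density of the projected measure along dyadic radii. -/
def lowDens (P : Λ → (EuclideanSpace ℝ (Fin n) →ₗ[ℝ] EuclideanSpace ℝ (Fin m)))
    (ν : Measure (EuclideanSpace ℝ (Fin n))) (l : Λ) (u : EuclideanSpace ℝ (Fin m)) : ℝ≥0∞ :=
  liminf (fun j : ℕ => ν {y | ‖P l y - u‖ ≤ (1 / 2 : ℝ) ^ j} /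
    ENNReal.ofReal (((1 / 2 : ℝ) ^ j) ^ m)) atTop

lemma aux_meas (P : Λ → (EuclideanSpace ℝ (Fin n) →ₗ[ℝ] EuclideanSpace ℝ (Fin m)))
    (hPcont : ∀ x, Continuous fun l => P l x)
    (ν : Measure (EuclideanSpace ℝ (Fin n))) [IsFiniteMeasure ν] :
    Measurable (fun p : Λ × EuclideanSpace ℝ (Fin m) => lowDens P ν p.1 p.2) := by
  unfold lowDens
  refine Measurable.liminf fun j => ?_
  refine Measurable.div_const ?_ _
  have hc := aux_cont P hPcont
  have hS : MeasurableSet {q : (Λ × EuclideanSpace ℝ (Fin m)) × EuclideanSpace ℝ (Fin n) |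
      ‖P q.1.1 q.2 - q.1.2‖ ≤ (1 / 2 : ℝ) ^ j} := by
    refine IsClosed.measurableSet (isClosed_le ?_ continuous_const)
    have : Continuous (fun q : (Λ × EuclideanSpace ℝ (Fin m)) × EuclideanSpace ℝ (Fin n) =>
      P q.1.1 q.2) := hc.comp (f := fun q : (Λ × EuclideanSpace ℝ (Fin m)) ×
        EuclideanSpace ℝ (Fin n) => (q.1.1, q.2)) (by fun_prop)
    fun_prop
  exact measurable_measure_prodMk_left (ν := ν) hS

lemma aux_ae (P : Λ → (EuclideanSpace ℝ (Fin n) →ₗ[ℝ] EuclideanSpace ℝ (Fin m)))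
    (ν : Measure (EuclideanSpace ℝ (Fin n))) [IsFiniteMeasure ν] (l : Λ) :
    ∀ᵐ u ∂(volume : Measure (EuclideanSpace ℝ (Fin m))),
      densD (ν.map (P l)) u = (ν.map (P l)).rnDeriv volume u ∧
      lowDens P ν l u = volume (closedBall (0 : EuclideanSpace ℝ (Fin m)) 1) *
        (ν.map (P l)).rnDeriv volume u := by
  have hPm : Measurable (P l) := (P l).continuous_of_finiteDimensional.measurable
  filter_upwards [Besicovitch.ae_tendsto_rnDeriv (ν.map (P l))
    (volume : Measure (EuclideanSpace ℝ (Fin m)))] with u hu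
  set α := volume (closedBall (0 : EuclideanSpace ℝ (Fin m)) 1) with hα
  have hα0 : α ≠ 0 := (measure_closedBall_pos _ _ one_pos).ne'
  have hαt : α ≠ ∞ := measure_closedBall_lt_top.ne
  have h1 : Tendsto (fun δ : ℝ => (ν.map (P l)) (closedBall u δ) /
      (α * ENNReal.ofReal (δ ^ m))) (𝓝[>] 0) (𝓝 ((ν.map (P l)).rnDeriv volume u)) := by
    refine hu.congr' ?_
    filter_upwards [self_mem_nhdsWithin] with δ hδ
    rw [Measure.addHaar_closedBall' volume _ (le_of_lt hδ), finrank_euclideanSpace, Fintype.card_fin,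
      mul_comm]
  refine ⟨h1.limUnder_eq, ?_⟩
  have h2 : Tendsto (fun j : ℕ => (1 / 2 : ℝ) ^ j) atTop (𝓝[>] 0) := by
    refine tendsto_nhdsWithin_iff.2 ⟨tendsto_pow_atTop_nhds_zero_of_lt_one (by norm_num)
      (by norm_num), Eventually.of_forall fun j => ?_⟩
    simp
  have h3 := ENNReal.Tendsto.const_mul (a := α) (h1.comp h2) (Or.inr hαt)
  refine Tendsto.liminf_eq (h3.congr fun j => ?_)
  simp only [Function.comp]
  rw [Measure.map_apply hPm measurableSet_closedBall]
  have : (P l) ⁻¹' closedBall u ((1 / 2 : ℝ) ^ j) = {y | ‖P l y - u‖ ≤ (1 / 2 : ℝ) ^ j} := by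
    ext y; simp [dist_eq_norm]
  rw [this, div_eq_mul_inv, div_eq_mul_inv, ENNReal.mul_inv (Or.inl hα0) (Or.inl hαt),
    mul_left_comm, ← mul_assoc α, ENNReal.mul_inv_cancel hα0 hαt]
  simp only [one_mul, div_eq_mul_inv]

lemma aux_unit {s : ℝ} (ω : Measure Λ) [IsFiniteMeasure ω]
    (P : Λ → (EuclideanSpace ℝ (Fin n) →ₗ[ℝ] EuclideanSpace ℝ (Fin m)))
    (hPcont : ∀ x, Continuous fun l => P l x)
    (C : ℝ)
    (hmain : ∀ μ' : Measure (EuclideanSpace ℝ (Fin n)), IsFiniteMeasure μ' → μ' ≠ 0 →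
      (∃ K, IsCompact K ∧ K ⊆ closedBall 0 1 ∧ μ' Kᶜ = 0) →
      (∀ x r, 0 < r → μ' (closedBall x r) ≤ ENNReal.ofReal (r ^ s)) →
      (∀ᵐ l ∂ω, μ'.map (P l) ≪ volume) ∧
        ∫⁻ l, ∫⁻ u, densD (μ'.map (P l)) u ^ 2 ∂volume ∂ω < ENNReal.ofReal C)
    (ν : Measure (EuclideanSpace ℝ (Fin n))) [IsFiniteMeasure ν]
    (hsupp : ν (closedBall 0 1)ᶜ = 0)
    (hfr : ∀ x r, 0 < r → ν (closedBall x r) ≤ ENNReal.ofReal (r ^ s)) :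
    ∫⁻ l, ∫⁻ z, lowDens P ν l (P l z) ∂ν ∂ω ≤
      volume (closedBall (0 : EuclideanSpace ℝ (Fin m)) 1) * ENNReal.ofReal C := by
  by_cases h0 : ν = 0
  · simp [h0]
  obtain ⟨hac, hint⟩ := hmain ν inferInstance h0
    ⟨closedBall 0 1, isCompact_closedBall _ _, le_rfl, hsupp⟩ hfr
  set α := volume (closedBall (0 : EuclideanSpace ℝ (Fin m)) 1) with hα
  have hαt : α ≠ ∞ := measure_closedBall_lt_top.ne
  have key : ∀ᵐ l ∂ω, ∫⁻ z, lowDens P ν l (P l z) ∂ν =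
      α * ∫⁻ u, densD (ν.map (P l)) u ^ 2 ∂volume := by
    filter_upwards [hac] with l hl
    have hPm : Measurable (P l) := (P l).continuous_of_finiteDimensional.measurable
    have hHm : Measurable (lowDens P ν l) := by
      have hh := (aux_meas P hPcont ν).comp
        (measurable_prodMk_left (x := l) (β := EuclideanSpace ℝ (Fin m)))
      exact hh
    have e1 := lintegral_map (μ := ν) hHm hPm
    have e2 := lintegral_rnDeriv_mul hl (hHm.aemeasurable (μ := volume))
    rw [← e1, ← e2, ← lintegral_const_mul' _ _ hαt]
    refine lintegral_congr_ae ?_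
    filter_upwards [aux_ae P ν l] with u hu
    rw [hu.1, hu.2]
    ring
  rw [lintegral_congr_ae key, lintegral_const_mul' _ _ hαt]
  gcongr


/-- The quantity at scale `r`, without the factor `r ^ t`. -/
def scaleDens (P : Λ → (EuclideanSpace ℝ (Fin n) →ₗ[ℝ] EuclideanSpace ℝ (Fin m)))
    (μ : Measure (EuclideanSpace ℝ (Fin n))) (r : ℝ) (l : Λ) (x : EuclideanSpace ℝ (Fin n)) :
    ℝ≥0∞ :=
  liminf (fun δ : ℝ => μ {y | y ∈ closedBall x r ∧ ‖P l (y - x)‖ ≤ δ} /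
    ENNReal.ofReal (δ ^ m)) (𝓝[>] 0)

lemma aux_ball {s : ℝ} (hs0 : 0 < s) (ω : Measure Λ) [IsFiniteMeasure ω]
    (P : Λ → (EuclideanSpace ℝ (Fin n) →ₗ[ℝ] EuclideanSpace ℝ (Fin m)))
    (hPcont : ∀ x, Continuous fun l => P l x)
    (C : ℝ)
    (hmain : ∀ μ' : Measure (EuclideanSpace ℝ (Fin n)), IsFiniteMeasure μ' → μ' ≠ 0 →
      (∃ K, IsCompact K ∧ K ⊆ closedBall 0 1 ∧ μ' Kᶜ = 0) →
      (∀ x r, 0 < r → μ' (closedBall x r) ≤ ENNReal.ofReal (r ^ s)) →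
      (∀ᵐ l ∂ω, μ'.map (P l) ≪ volume) ∧
        ∫⁻ l, ∫⁻ u, densD (μ'.map (P l)) u ^ 2 ∂volume ∂ω < ENNReal.ofReal C)
    (μ : Measure (EuclideanSpace ℝ (Fin n))) [IsFiniteMeasure μ]
    (hfr : ∀ x r, 0 < r → μ (closedBall x r) ≤ ENNReal.ofReal ((r / 2) ^ s))
    (a : EuclideanSpace ℝ (Fin n)) (r : ℝ) (hr : 0 < r) :
    ∃ F : Λ × EuclideanSpace ℝ (Fin n) → ℝ≥0∞, Measurable F ∧
      (∀ l, ∀ x ∈ closedBall a r, scaleDens P μ r l x ≤ F (l, x)) ∧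
      ∫⁻ l, ∫⁻ x, F (l, x) ∂μ ∂ω ≤
        ENNReal.ofReal ((2 * r) ^ (s - m)) * (ENNReal.ofReal ((2 * r) ^ s) *
        (volume (closedBall (0 : EuclideanSpace ℝ (Fin m)) 1) * ENNReal.ofReal C)) := by
  set g : EuclideanSpace ℝ (Fin n) → EuclideanSpace ℝ (Fin n) :=
    fun y => (2 * r)⁻¹ • (y - a) with hg
  have hgc : Continuous g := by fun_prop
  have hgm : Measurable g := hgc.measurable
  set κ := μ.restrict (closedBall a (2 * r)) with hκ
  set ν := ENNReal.ofReal ((2 * r) ^ (-s)) • κ.map g with hν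
  have h2r : 0 < 2 * r := by positivity
  have hpre : ∀ x ρ, g ⁻¹' closedBall x ρ = closedBall (a + (2 * r) • x) (2 * r * ρ) := by
    intro x ρ
    ext y
    have : y - (a + (2 * r) • x) = (2 * r) • (g y - x) := by
      rw [hg, smul_sub, smul_smul, mul_inv_cancel₀ h2r.ne', one_smul]; abel
    rw [Set.mem_preimage, mem_closedBall, mem_closedBall, dist_eq_norm, dist_eq_norm, this,
      norm_smul, Real.norm_of_nonneg h2r.le, mul_le_mul_iff_right₀ h2r]
  have : IsFiniteMeasure (κ.map g) := Measure.isFiniteMeasure_map κ g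
  have : IsFiniteMeasure ν := Measure.smul_finite _ ENNReal.ofReal_ne_top
  have hsupp : ν (closedBall 0 1)ᶜ = 0 := by
    rw [hν, Measure.smul_apply, Measure.map_apply hgm measurableSet_closedBall.compl,
      Set.preimage_compl, hpre, hκ]
    simp [Measure.restrict_apply measurableSet_closedBall.compl]
  have hνfr : ∀ x ρ, 0 < ρ → ν (closedBall x ρ) ≤ ENNReal.ofReal (ρ ^ s) := by
    intro x ρ hρ
    rw [hν, Measure.smul_apply, Measure.map_apply hgm measurableSet_closedBall, hpre, smul_eq_mul]
    calc _ ≤ ENNReal.ofReal ((2 * r) ^ (-s)) * ENNReal.ofReal ((2 * r * ρ / 2) ^ s) := by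
          gcongr
          exact (Measure.restrict_apply_le _ _).trans (hfr _ _ (by positivity))
      _ ≤ _ := by
          rw [← ENNReal.ofReal_mul (by positivity)]
          refine ENNReal.ofReal_le_ofReal ?_
          have : 2 * r * ρ / 2 = (2 * r) * (ρ / 2) := by ring
          rw [this, Real.mul_rpow h2r.le (by positivity), ← mul_assoc, ← Real.rpow_add h2r]
          simp only [neg_add_cancel, Real.rpow_zero, one_mul]
          exact Real.rpow_le_rpow (by positivity) (by linarith) hs0.le
  have hmap : κ.map g = ENNReal.ofReal ((2 * r) ^ s) • ν := by
    rw [hν, smul_smul, ← ENNReal.ofReal_mul (by positivity), ← Real.rpow_add h2r]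
    simp
  have hunit := aux_unit ω P hPcont C hmain ν hsupp hνfr
  have hPP := aux_cont P hPcont
  set F0 : Λ × EuclideanSpace ℝ (Fin n) → ℝ≥0∞ := fun p => lowDens P ν p.1 (P p.1 (g p.2)) with hF0
  have hF0m : Measurable F0 := by
    have h1 : Continuous (fun p : Λ × EuclideanSpace ℝ (Fin n) => (p.1, P p.1 (g p.2))) := by
      refine continuous_fst.prodMk ?_
      exact hPP.comp (f := fun p : Λ × EuclideanSpace ℝ (Fin n) => (p.1, g p.2)) (by fun_prop)
    have hh := (aux_meas P hPcont ν).comp h1.measurable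
    exact hh
  refine ⟨fun p => (closedBall a (2 * r)).indicator
    (fun x => ENNReal.ofReal ((2 * r) ^ (s - m)) * F0 (p.1, x)) p.2, ?_, ?_, ?_⟩
  · have : MeasurableSet {p : Λ × EuclideanSpace ℝ (Fin n) | p.2 ∈ closedBall a (2 * r)} :=
      measurable_snd measurableSet_closedBall
    exact (hF0m.const_mul _).indicator this
  · intro l x hx
    have hx' : x ∈ closedBall a (2 * r) := closedBall_subset_closedBall (by linarith) hx
    simp only [Set.indicator_of_mem hx']
    have hseq : Tendsto (fun j : ℕ => (2 * r) * (1 / 2 : ℝ) ^ j) atTop (𝓝[>] 0) := by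
      refine tendsto_nhdsWithin_iff.2 ⟨?_, Eventually.of_forall fun j => ?_⟩
      · simpa using (tendsto_pow_atTop_nhds_zero_of_lt_one (r := (1 / 2 : ℝ)) (by norm_num)
          (by norm_num)).const_mul (2 * r)
      · simp only [Set.mem_Ioi]; positivity
    have hle : scaleDens P μ r l x ≤ liminf (fun j : ℕ =>
        μ {y | y ∈ closedBall x r ∧ ‖P l (y - x)‖ ≤ (2 * r) * (1 / 2 : ℝ) ^ j} /
        ENNReal.ofReal (((2 * r) * (1 / 2 : ℝ) ^ j) ^ m)) atTop := by
      unfold scaleDens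
      exact liminf_le_liminf_of_le (f := 𝓝[>] (0 : ℝ))
        (g := Filter.map (fun j : ℕ => (2 * r) * (1 / 2 : ℝ) ^ j) atTop) hseq
    refine hle.trans ?_
    rw [hF0]
    simp only [lowDens]
    rw [← ENNReal.liminf_const_mul_of_ne_top ENNReal.ofReal_ne_top]
    refine liminf_le_liminf (Eventually.of_forall fun j => ?_)
    set d : ℝ := (1 / 2 : ℝ) ^ j with hd
    have hd0 : 0 < d := by positivity
    have hPl : Continuous (P l) := (P l).continuous_of_finiteDimensional
    have hSm : MeasurableSet {y | ‖P l y - P l (g x)‖ ≤ d} :=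
      (isClosed_le (by fun_prop) continuous_const).measurableSet
    have hmeas : μ {y | y ∈ closedBall x r ∧ ‖P l (y - x)‖ ≤ (2 * r) * d} ≤
        κ.map g {y | ‖P l y - P l (g x)‖ ≤ d} := by
      rw [Measure.map_apply hgm hSm, hκ, Measure.restrict_apply (hgm hSm)]
      refine measure_mono fun y hy => ⟨?_, ?_⟩
      · have e : P l (g y) - P l (g x) = (2 * r)⁻¹ • P l (y - x) := by
          rw [← map_sub, ← map_smul, hg]
          congr 1
          rw [← smul_sub]; congr 1; abel
        simp only [Set.mem_preimage, Set.mem_ofPred_eq]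
        rw [e, norm_smul, Real.norm_of_nonneg (by positivity), inv_mul_le_iff₀ h2r]
        exact hy.2
      · have h1 := mem_closedBall.1 hy.1
        have h2 := mem_closedBall.1 hx
        rw [mem_closedBall]
        linarith [dist_triangle y x a]
    calc _ ≤ κ.map g {y | ‖P l y - P l (g x)‖ ≤ d} / ENNReal.ofReal (((2 * r) * d) ^ m) := by
          gcongr
      _ = _ := by
          rw [hmap, Measure.smul_apply, smul_eq_mul, div_eq_mul_inv, div_eq_mul_inv, mul_pow,
            ENNReal.ofReal_mul (by positivity), ENNReal.mul_inv
              (Or.inl (by simp only [ne_eq, ENNReal.ofReal_eq_zero, not_le]; positivity))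
              (Or.inl ENNReal.ofReal_ne_top), ← ENNReal.ofReal_inv_of_pos (by positivity)]
          have : (2 * r) ^ (s - m) = (2 * r) ^ s * ((2 * r) ^ m)⁻¹ := by
            rw [Real.rpow_sub h2r, Real.rpow_natCast, div_eq_mul_inv]
          rw [this, ENNReal.ofReal_mul (by positivity)]
          ring
  · have h1 : ∀ l, ∫⁻ x, (closedBall a (2 * r)).indicator
        (fun x => ENNReal.ofReal ((2 * r) ^ (s - m)) * F0 (l, x)) x ∂μ =
        ENNReal.ofReal ((2 * r) ^ (s - m)) * (ENNReal.ofReal ((2 * r) ^ s) *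
          ∫⁻ z, lowDens P ν l (P l z) ∂ν) := by
      intro l
      have hLm : Measurable (fun z => lowDens P ν l (P l z)) := by
        have h1 : Continuous (fun z : EuclideanSpace ℝ (Fin n) => (l, P l z)) := by
          refine continuous_const.prodMk (P l).continuous_of_finiteDimensional
        have hh := (aux_meas P hPcont ν).comp h1.measurable
        exact hh
      rw [lintegral_indicator measurableSet_closedBall,
        lintegral_const_mul' _ _ ENNReal.ofReal_ne_top]
      congr 1
      have e1 := lintegral_map (μ := κ) hLm hgm
      rw [hmap, lintegral_smul_measure, smul_eq_mul] at e1
      exact e1.symm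
    simp only [h1]
    rw [lintegral_const_mul' _ _ ENNReal.ofReal_ne_top,
      lintegral_const_mul' _ _ ENNReal.ofReal_ne_top]
    gcongr

lemma aux_cover (μ : Measure (EuclideanSpace ℝ (Fin n))) [IsFiniteMeasure μ]
    (S : Set (EuclideanSpace ℝ (Fin n))) (r c : ℝ) (hr : 0 < r) (hc : 0 < c)
    (hS : ∀ a ∈ S, ENNReal.ofReal c ≤ μ (closedBall a (r / 3))) :
    ∃ T : Finset (EuclideanSpace ℝ (Fin n)),
      (T.card : ℝ) ≤ (μ Set.univ).toReal / c ∧ ∀ x ∈ S, ∃ a ∈ T, x ∈ closedBall a r := by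
  classical
  set good : Set (Finset (EuclideanSpace ℝ (Fin n))) :=
    {T | (∀ a ∈ T, a ∈ S) ∧ ∀ a ∈ T, ∀ a' ∈ T, a ≠ a' → r < dist a a'} with hgood
  have hcard : ∀ T ∈ good, (T.card : ℝ) ≤ (μ Set.univ).toReal / c := by
    intro T hT
    rw [le_div_iff₀ hc]
    have hdisj : (T : Set (EuclideanSpace ℝ (Fin n))).PairwiseDisjoint
        (fun a => closedBall a (r / 3)) := by
      intro a ha a' ha' hne
      refine closedBall_disjoint_closedBall ?_
      have := hT.2 a ha a' ha' hne
      linarith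
    have h1 : ∑ a ∈ T, μ (closedBall a (r / 3)) ≤ μ Set.univ := by
      rw [← measure_biUnion_finset hdisj (fun a _ => measurableSet_closedBall)]
      exact measure_mono (Set.subset_univ _)
    have h2 : (T.card : ℝ≥0∞) * ENNReal.ofReal c ≤ μ Set.univ := by
      refine le_trans ?_ h1
      rw [← nsmul_eq_mul]
      exact Finset.card_nsmul_le_sum _ _ _ (fun a ha => hS a (hT.1 a ha))
    have h3 := ENNReal.toReal_mono (measure_ne_top μ _) h2
    rwa [ENNReal.toReal_mul, ENNReal.toReal_natCast, ENNReal.toReal_ofReal hc.le] at h3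
  have hne : (Finset.card '' good).Nonempty := ⟨0, ∅, by simp [hgood], rfl⟩
  have hbdd : BddAbove (Finset.card '' good) := by
    refine ⟨⌊(μ Set.univ).toReal / c⌋₊, ?_⟩
    rintro _ ⟨T, hT, rfl⟩
    exact Nat.le_floor (hcard T hT)
  obtain ⟨T, hT, hTe⟩ := Nat.sSup_mem hne hbdd
  refine ⟨T, hcard T hT, fun x hx => ?_⟩
  by_contra! hcon
  have hfar : ∀ a ∈ T, r < dist x a := by
    intro a ha
    have := hcon a ha
    rwa [mem_closedBall, not_le] at this
  have hxT : x ∉ T := fun h => by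
    have := hfar x h
    rw [dist_self] at this
    linarith
  have hin : insert x T ∈ good := by
    refine ⟨?_, ?_⟩
    · intro a ha
      rcases Finset.mem_insert.1 ha with rfl | ha2
      · exact hx
      · exact hT.1 a ha2
    · intro a ha a' ha' hne
      rcases Finset.mem_insert.1 ha with rfl | ha2
      · rcases Finset.mem_insert.1 ha' with rfl | ha3
        · exact absurd rfl hne
        · exact hfar a' ha3
      · rcases Finset.mem_insert.1 ha' with rfl | ha3
        · rw [dist_comm]; exact hfar a ha2
        · exact hT.2 a ha2 a' ha3 hne
  have := le_csSup hbdd ⟨_, hin, rfl⟩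
  rw [← hTe, Finset.card_insert_of_notMem hxT] at this
  omega

lemma aux_scale {s : ℝ} (hs0 : 0 < s) (ω : Measure Λ) [IsFiniteMeasure ω]
    (P : Λ → (EuclideanSpace ℝ (Fin n) →ₗ[ℝ] EuclideanSpace ℝ (Fin m)))
    (hPcont : ∀ x, Continuous fun l => P l x)
    (C : ℝ)
    (hmain : ∀ μ' : Measure (EuclideanSpace ℝ (Fin n)), IsFiniteMeasure μ' → μ' ≠ 0 →
      (∃ K, IsCompact K ∧ K ⊆ closedBall 0 1 ∧ μ' Kᶜ = 0) →
      (∀ x r, 0 < r → μ' (closedBall x r) ≤ ENNReal.ofReal (r ^ s)) →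
      (∀ᵐ l ∂ω, μ'.map (P l) ≪ volume) ∧
        ∫⁻ l, ∫⁻ u, densD (μ'.map (P l)) u ^ 2 ∂volume ∂ω < ENNReal.ofReal C)
    (μ : Measure (EuclideanSpace ℝ (Fin n))) [IsFiniteMeasure μ]
    (hfr : ∀ x r, 0 < r → μ (closedBall x r) ≤ ENNReal.ofReal ((r / 2) ^ s))
    (b r₀ : ℝ) (hb : 0 < b) (S : Set (EuclideanSpace ℝ (Fin n)))
    (hS : ∀ a ∈ S, ∀ r, 0 < r → r < r₀ → ENNReal.ofReal (b * r ^ s) ≤ μ (closedBall a r))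
    (r : ℝ) (hr : 0 < r) (hr' : r < r₀) :
    ∃ F : Λ × EuclideanSpace ℝ (Fin n) → ℝ≥0∞, Measurable F ∧
      (∀ l, ∀ x ∈ S, scaleDens P μ r l x ≤ F (l, x)) ∧
      ∫⁻ l, ∫⁻ x, F (l, x) ∂μ ∂ω ≤
        ENNReal.ofReal ((2 * r) ^ (s - m)) * (ENNReal.ofReal ((μ Set.univ).toReal / b * 6 ^ s) *
        (volume (closedBall (0 : EuclideanSpace ℝ (Fin m)) 1) * ENNReal.ofReal C)) := by
  obtain ⟨T, hTc, hTcov⟩ := aux_cover μ S r (b * (r / 3) ^ s) hr (by positivity)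
    (fun a ha => hS a ha _ (by positivity) (by linarith))
  choose F hFm hF1 hF2 using fun a => aux_ball hs0 ω P hPcont C hmain μ hfr a r hr
  refine ⟨fun p => ∑ a ∈ T, F a p, Finset.measurable_sum _ fun a _ => hFm a, ?_, ?_⟩
  · intro l x hx
    obtain ⟨a, haT, hxa⟩ := hTcov x hx
    exact (hF1 a l x hxa).trans (Finset.single_le_sum (f := fun a => F a (l, x))
      (fun _ _ => zero_le) haT)
  · have h1 : ∀ l, ∫⁻ x, ∑ a ∈ T, F a (l, x) ∂μ = ∑ a ∈ T, ∫⁻ x, F a (l, x) ∂μ := fun l =>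
      lintegral_finsetSum _ fun a _ => (hFm a).comp measurable_prodMk_left
    simp only [h1]
    rw [lintegral_finsetSum _ fun a _ => (hFm a).lintegral_prod_right']
    refine (Finset.sum_le_card_nsmul _ _ _ fun a _ => hF2 a).trans ?_
    rw [nsmul_eq_mul, mul_left_comm, ← mul_assoc (T.card : ℝ≥0∞)]
    gcongr
    rw [← ENNReal.ofReal_natCast, ← ENNReal.ofReal_mul (by positivity)]
    refine ENNReal.ofReal_le_ofReal ?_
    calc (T.card : ℝ) * (2 * r) ^ s ≤ (μ Set.univ).toReal / (b * (r / 3) ^ s) * (2 * r) ^ s := by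
          gcongr
      _ = _ := by
          have : 2 * r = 6 * (r / 3) := by ring
          rw [this, Real.mul_rpow (by norm_num) (by positivity)]
          have : (r / 3) ^ s ≠ 0 := by positivity
          field_simp

end aux

theorem stmt8 {n m : ℕ} (hm : 1 ≤ m) (hmn : m < n) {s : ℝ} (hs : (m : ℝ) < s)
    {Λ : Type*} [MetricSpace Λ] [CompactSpace Λ] [MeasurableSpace Λ] [BorelSpace Λ]
    (ω : Measure Λ) [IsFiniteMeasure ω] (hω : ω ≠ 0)
    (P : Λ → (EuclideanSpace ℝ (Fin n) →ₗ[ℝ] EuclideanSpace ℝ (Fin m)))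
    (hP : ∀ l, IsOrthoProj (P l))
    (hPcont : ∀ x, Continuous fun l => P l x)
    (C : ℝ) (hC : 0 < C)
    (hmain : ∀ μ' : Measure (EuclideanSpace ℝ (Fin n)), IsFiniteMeasure μ' → μ' ≠ 0 →
      (∃ K, IsCompact K ∧ K ⊆ closedBall 0 1 ∧ μ' Kᶜ = 0) →
      (∀ x r, 0 < r → μ' (closedBall x r) ≤ ENNReal.ofReal (r ^ s)) →
      (∀ᵐ l ∂ω, μ'.map (P l) ≪ volume) ∧
        ∫⁻ l, ∫⁻ u, densD (μ'.map (P l)) u ^ 2 ∂volume ∂ω < ENNReal.ofReal C)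
    (A : Set (EuclideanSpace ℝ (Fin n))) (hAc : IsCompact A) (hAm : NullMeasurableSet A μH[s])
    (hA0 : 0 < μH[s] A) (hA1 : μH[s] A < ∞)
    (μ : Measure (EuclideanSpace ℝ (Fin n)))
    (hμ : μ = ((10 : ℝ≥0∞) ^ (-s)) • μH[s].restrict A)
    (hfrostman : ∀ x r, 0 < r → μ (closedBall x r) ≤ ENNReal.ofReal ((r / 2) ^ s))
    (hlow : ∃ b r₀ : ℝ, 0 < b ∧ 0 < r₀ ∧
      ∀ a : EuclideanSpace ℝ (Fin n), (∀ ε : ℝ, 0 < ε → 0 < μ (ball a ε)) →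
        ∀ r, 0 < r → r < r₀ → ENNReal.ofReal (b * r ^ s) ≤ μ (closedBall a r)) :
    ∀ t : ℝ, 0 < t → t < s - m →
      ∀ᵐ l ∂ω, ∀ᵐ x ∂μ,
        Tendsto (fun r : ℝ =>
            liminf (fun δ : ℝ =>
                μ {y | y ∈ closedBall x r ∧ ‖P l (y - x)‖ ≤ δ} /
                  ENNReal.ofReal (r ^ t * δ ^ m)) (𝓝[>] 0))
          (𝓝[>] 0) (𝓝 0) := by
  intro t ht hts
  have hs0 : 0 < s := lt_of_le_of_lt (Nat.cast_nonneg m) hs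
  have hfin : IsFiniteMeasure μ := by
    refine ⟨?_⟩
    rw [hμ, Measure.smul_apply, Measure.restrict_apply_univ, smul_eq_mul]
    refine ENNReal.mul_lt_top ?_ hA1
    rw [lt_top_iff_ne_top]
    exact ENNReal.rpow_ne_top_of_ne_zero (by norm_num) (by norm_num)
  obtain ⟨b, r₀, hb, hr₀, hlow⟩ := hlow
  have hS : ∀ a ∈ μ.support, ∀ r, 0 < r → r < r₀ →
      ENNReal.ofReal (b * r ^ s) ≤ μ (closedBall a r) := fun a ha =>
    hlow a fun ε hε => (Measure.mem_support_iff_forall a).1 ha _ (ball_mem_nhds a hε)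
  set r₁ := r₀ / 2 with hr₁
  have hr₁0 : 0 < r₁ := by positivity
  set ρ : ℕ → ℝ := fun k => r₁ * (1 / 2 : ℝ) ^ k with hρ
  have hρ0 : ∀ k, 0 < ρ k := fun k => by simp only [hρ]; positivity
  have hρlt : ∀ k, ρ k < r₀ := fun k => by
    have : ρ k ≤ r₁ * 1 := by
      simp only [hρ]; gcongr; exact pow_le_one₀ (by norm_num) (by norm_num)
    linarith
  choose G hGm hG1 hG2 using fun k => aux_scale hs0 ω P hPcont C hmain μ hfrostman b r₀ hb
    μ.support hS (ρ k) (hρ0 k) (hρlt k)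
  set w : ℕ → ℝ≥0∞ := fun k => ENNReal.ofReal (ρ (k + 1) ^ (-t)) with hw
  set K : ℝ≥0∞ := (ENNReal.ofReal ((μ Set.univ).toReal / b * 6 ^ s) *
        (volume (closedBall (0 : EuclideanSpace ℝ (Fin m)) 1) * ENNReal.ofReal C)) with hK
  have hKt : K ≠ ∞ := ENNReal.mul_ne_top ENNReal.ofReal_ne_top
    (ENNReal.mul_ne_top measure_closedBall_lt_top.ne ENNReal.ofReal_ne_top)
  have hwm : ∀ k, Measurable (fun p => w k * G k p) := fun k => (hGm k).const_mul _
  set q : ℝ := (1 / 2 : ℝ) ^ (s - m - t) with hq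
  have hq0 : 0 < q := by positivity
  have hq1 : q < 1 := Real.rpow_lt_one (by norm_num) (by norm_num) (by linarith)
  set c : ℝ := 4 ^ (s - m) * (r₁ / 2) ^ (s - m - t) with hc
  have hwk : ∀ k, w k * ENNReal.ofReal ((2 * ρ k) ^ (s - m)) = ENNReal.ofReal (c * q ^ k) := by
    intro k
    rw [hw, ← ENNReal.ofReal_mul (Real.rpow_nonneg (hρ0 _).le _)]
    congr 1
    have e1 : 2 * ρ k = 4 * ρ (k + 1) := by simp only [hρ]; ring
    have e2 : ρ (k + 1) = (r₁ / 2) * (1 / 2 : ℝ) ^ k := by simp only [hρ]; ring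
    rw [e1, Real.mul_rpow (by norm_num) (hρ0 _).le, mul_left_comm, ← Real.rpow_add (hρ0 _), hc,
      mul_assoc, show -t + (s - m) = s - m - t by ring, e2,
      Real.mul_rpow (by positivity) (by positivity), hq, ← Real.rpow_natCast, ← Real.rpow_mul
      (by norm_num), ← Real.rpow_natCast, ← Real.rpow_mul (by norm_num), mul_comm (k : ℝ)]
  have hsum : ∑' k, ENNReal.ofReal (c * q ^ k) ≠ ∞ := by
    have hsm : Summable (fun k => c * q ^ k) :=
      (summable_geometric_of_lt_one hq0.le hq1).mul_left c
    rw [← ENNReal.ofReal_tsum_of_nonneg (fun k => by positivity) hsm]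
    exact ENNReal.ofReal_ne_top
  have hTm : Measurable (fun p => ∑' k, w k * G k p) := Measurable.tsum hwm
  have hint : ∫⁻ l, ∫⁻ x, ∑' k, w k * G k (l, x) ∂μ ∂ω ≠ ∞ := by
    have h1 : ∀ l, ∫⁻ x, ∑' k, w k * G k (l, x) ∂μ = ∑' k, w k * ∫⁻ x, G k (l, x) ∂μ := by
      intro l
      have hm1 : ∀ k, AEMeasurable (fun x => w k * G k (l, x)) μ := fun k =>
        ((hwm k).comp (measurable_prodMk_left (x := l))).aemeasurable
      rw [lintegral_tsum hm1]
      congr 1; ext k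
      exact lintegral_const_mul' _ _ ENNReal.ofReal_ne_top
    simp only [h1]
    rw [lintegral_tsum fun k => ((hGm k).lintegral_prod_right'.const_mul _).aemeasurable]
    refine ne_top_of_le_ne_top (ENNReal.mul_ne_top hsum hKt) ?_
    rw [← ENNReal.tsum_mul_right]
    refine ENNReal.tsum_le_tsum fun k => ?_
    rw [lintegral_const_mul' _ _ ENNReal.ofReal_ne_top, ← hwk k, mul_assoc]
    gcongr
    exact hG2 k
  have hae := ae_lt_top hTm.lintegral_prod_right' hint
  filter_upwards [hae] with l hl
  have hae2 := ae_lt_top (hTm.comp (measurable_prodMk_left (x := l))) hl.ne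
  filter_upwards [hae2, Measure.support_mem_ae (μ := μ)] with x hx hxS
  have hlim : Tendsto (fun k => w k * G k (l, x)) atTop (𝓝 0) :=
    ENNReal.tendsto_atTop_zero_of_tsum_ne_top hx.ne
  rw [ENNReal.tendsto_nhds_zero] at hlim ⊢
  intro ε hε
  obtain ⟨N, hN⟩ := eventually_atTop.1 (hlim ε hε)
  filter_upwards [Ioo_mem_nhdsGT (hρ0 N)] with r hr
  have hr0 : 0 < r := hr.1
  have hrr : r / r₁ ≤ 1 := by
    rw [div_le_one hr₁0]
    have : ρ N ≤ r₁ * 1 := by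
      simp only [hρ]; gcongr; exact pow_le_one₀ (by norm_num) (by norm_num)
    linarith [hr.2]
  obtain ⟨k, hk1, hk2⟩ := exists_nat_pow_near_of_lt_one (div_pos hr0 hr₁0) hrr
    (show (0 : ℝ) < 1 / 2 by norm_num) (by norm_num)
  rw [lt_div_iff₀' hr₁0] at hk1
  rw [div_le_iff₀' hr₁0] at hk2
  have hkN : N ≤ k := by
    by_contra! hlt
    have : ρ N ≤ ρ (k + 1) := by
      simp only [hρ]
      exact mul_le_mul_of_nonneg_left (pow_le_pow_of_le_one (by norm_num) (by norm_num) hlt) hr₁0.le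
    linarith [hr.2]
  refine le_trans ?_ ((mul_le_mul_right (hG1 k l x hxS) (w k)).trans (hN k hkN))
  unfold scaleDens
  rw [← ENNReal.liminf_const_mul_of_ne_top ENNReal.ofReal_ne_top]
  refine liminf_le_liminf ?_
  filter_upwards [self_mem_nhdsWithin] with δ hδ
  have hδ0 : (0 : ℝ) < δ := hδ
  have hrt : 0 < r ^ t := by positivity
  rw [ENNReal.ofReal_mul hrt.le, div_eq_mul_inv, div_eq_mul_inv, ENNReal.mul_inv
    (Or.inl (by simpa using hrt)) (Or.inl ENNReal.ofReal_ne_top),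
    mul_left_comm, ← ENNReal.ofReal_inv_of_pos hrt, ← Real.rpow_neg hr0.le]
  have hball : closedBall x r ⊆ closedBall x (ρ k) := closedBall_subset_closedBall hk2
  have hmono : μ {y | y ∈ closedBall x r ∧ ‖P l (y - x)‖ ≤ δ} ≤
      μ {y | y ∈ closedBall x (ρ k) ∧ ‖P l (y - x)‖ ≤ δ} :=
    measure_mono fun y hy => ⟨hball hy.1, hy.2⟩
  have hwle : ENNReal.ofReal (r ^ (-t)) ≤ w k :=
    ENNReal.ofReal_le_ofReal (Real.rpow_le_rpow_of_nonpos (hρ0 _) hk1.le (by linarith))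
  gcongr

end
end
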